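/- arXiv:2402.07115 — 2 statements merged into one kernel-verified Lean document; each statement's English description precedes it below -/
import Mathlib

section
/- For every integer n ≥ 1, the series Σ_{m=0}^∞ c_m / n^{m/2} converges and its sum equals (24n/(24n−1)) · exp(μ(n) − π√(2n/3)) · (1 − 1/μ(n)), where μ(n) = (π/6)√(24n − 1). -/
open Real Finset Filter Topology

noncomputable def c (m : ℕ) : ℝ :=
  ((-1 : ℝ) ^ m / (4 * Real.sqrt 6) ^ m) *
    ∑ k ∈ Finset.range ((m + 1) / 2 + 1),
      ((m + 1).choose k : ℝ) * ((m + 1 - k : ℕ) : ℝ) / ((m + 1 - 2 * k).factorial : ℝ) *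
        (π / 6) ^ ((m : ℤ) - 2 * k)

noncomputable def μ (n : ℕ) : ℝ := π / 6 * Real.sqrt (24 * n - 1)

theorem Ring.multichoose_half_mul_four_pow (k : ℕ) :
    Ring.multichoose (1 / 2 : ℝ) k * 4 ^ k = (Nat.centralBinom k : ℝ) := by
  have h (k : ℕ) : (ascPochhammer ℝ k).eval (1 / 2) * 4 ^ k = k.factorial * Nat.centralBinom k := by
    induction k with
    | zero => simp
    | succ k ih =>
      have hc : ((k : ℝ) + 1) * (k + 1).centralBinom = 2 * (2 * k + 1) * k.centralBinom :=
        mod_cast Nat.succ_mul_centralBinom_succ k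
      rw [ascPochhammer_succ_eval, Nat.factorial_succ]
      push_cast
      linear_combination (4 * (1 / 2 + (k : ℝ))) * ih - (k.factorial : ℝ) * hc
  have hm := Ring.factorial_nsmul_multichoose_eq_ascPochhammer (1 / 2 : ℝ) k
  rw [Polynomial.ascPochhammer_smeval_eq_eval, nsmul_eq_mul] at hm
  have hk : (k.factorial : ℝ) ≠ 0 := by positivity
  apply mul_left_cancel₀ hk
  rw [← h k, ← hm, mul_assoc]

theorem hasSum_centralBinom {r : ℝ} (h0 : 0 < r) (h1 : r < 1) :
    HasSum (fun k : ℕ => (Nat.centralBinom k : ℝ) * ((1 - r ^ 2) / 4) ^ k) (1 / r) := by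
  have hs := (Real.one_div_one_sub_rpow_hasFPowerSeriesOnBall_zero (1 / 2)).hasSum
    (y := 1 - r ^ 2) (by
      have : |1 - r ^ 2| < 1 := by rw [abs_lt]; constructor <;> nlinarith
      simpa [enorm_eq_nnnorm, ← NNReal.coe_lt_coe] using this)
  have hr : (1 - (0 + (1 - r ^ 2))) ^ (1 / 2 : ℝ) = r := by
    rw [← Real.sqrt_eq_rpow, show 1 - (0 + (1 - r ^ 2)) = r ^ 2 by ring, Real.sqrt_sq h0.le]
  rw [hr] at hs
  refine hs.congr_fun ?_
  intro k
  rw [← Ring.multichoose_half_mul_four_pow, div_pow]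
  simp [Ring.multichoose_eq]
  field_simp

theorem choose_add_two_add_two_mul_eq_sub (j k : ℕ) : ((j + 2 + 2 * k).choose k : ℝ) =
    (j + 1 + 2 * (k + 1)).choose (k + 1) - (j + 2 * (k + 1)).choose (k + 1) := by
  rw [show j + 1 + 2 * (k + 1) = (j + 2 + 2 * k) + 1 by ring,
    show j + 2 * (k + 1) = j + 2 + 2 * k by ring, Nat.choose_succ_succ]
  push_cast
  ring

theorem two_mul_choose_one_add_two_mul (k : ℕ) :
    2 * ((1 + 2 * k).choose k : ℝ) = (Nat.centralBinom (k + 1) : ℝ) := by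
  rw [Nat.centralBinom_eq_two_mul_choose, show 2 * (k + 1) = (1 + 2 * k) + 1 by ring,
    Nat.choose_succ_succ, ← Nat.choose_symm_of_eq_add (show 1 + 2 * k = k + (k + 1) by ring)]
  push_cast
  ring

theorem hasSum_choose_add_two_mul {r : ℝ} (h0 : 0 < r) (h1 : r < 1) (j : ℕ) :
    HasSum (fun k : ℕ => ((j + 2 * k).choose k : ℝ) * ((1 - r ^ 2) / 4) ^ k)
      ((2 / (1 + r)) ^ j / r) := by
  have ht : (1 - r ^ 2) ≠ 0 := by nlinarith
  have hr : 1 + r ≠ 0 := by positivity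
  induction j using Nat.twoStepInduction with
  | zero =>
    simpa [Nat.centralBinom_eq_two_mul_choose] using hasSum_centralBinom h0 h1
  | one =>
    convert! ((hasSum_nat_add_iff' 1).2 (hasSum_centralBinom h0 h1)).mul_left
      (2 / (1 - r ^ 2)) using 1
    · ext k
      rw [← two_mul_choose_one_add_two_mul]
      field_simp
      ring
    · simp
      field_simp
      ring
  | more j ih0 ih1 =>
    convert! ((hasSum_nat_add_iff' 1).2 (ih1.sub ih0)).mul_left (4 / (1 - r ^ 2)) using 1
    · ext k
      rw [choose_add_two_add_two_mul_eq_sub]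
      field_simp
      ring
    · simp only [pow_succ, range_one, sum_singleton]
      generalize (2 / (1 + r)) ^ j = z
      simp
      field_simp
      ring

theorem hasSum_mul_centralBinom {r : ℝ} (h0 : 0 < r) (h1 : r < 1) :
    HasSum (fun k : ℕ => (k : ℝ) * (Nat.centralBinom k * ((1 - r ^ 2) / 4) ^ k))
      ((1 - r ^ 2) / (2 * r ^ 3)) := by
  have hB := hasSum_centralBinom h0 h1
  have hS : Summable (fun k : ℕ => (k : ℝ) * (Nat.centralBinom k * ((1 - r ^ 2) / 4) ^ k)) := by
    have ht : ‖1 - r ^ 2‖ < 1 := by rw [Real.norm_eq_abs, abs_lt]; constructor <;> nlinarith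
    have h := summable_pow_mul_geometric_of_norm_lt_one 1 ht
    refine h.of_nonneg_of_le (fun k => ?_) (fun k => ?_)
    · have : 0 ≤ (1 - r ^ 2) / 4 := by nlinarith
      positivity
    · have hk : (Nat.centralBinom k : ℝ) ≤ 4 ^ k := mod_cast Nat.centralBinom_le_four_pow k
      have : 0 ≤ (1 - r ^ 2) := by nlinarith
      calc (k : ℝ) * (Nat.centralBinom k * ((1 - r ^ 2) / 4) ^ k)
          ≤ k * (4 ^ k * ((1 - r ^ 2) / 4) ^ k) := by gcongr
        _ = k ^ 1 * (1 - r ^ 2) ^ k := by rw [← mul_pow]; ring_nf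
  obtain ⟨d, hd⟩ := hS
  have h2 := (hasSum_nat_add_iff' 1).2 hd
  have h3 := ((hd.mul_left 2).add hB).mul_left (2 * ((1 - r ^ 2) / 4))
  have hu : d - ∑ i ∈ range 1, (i : ℝ) * (Nat.centralBinom i * ((1 - r ^ 2) / 4) ^ i) =
      2 * ((1 - r ^ 2) / 4) * (2 * d + 1 / r) := by
    refine h2.unique (h3.congr_fun fun k => ?_)
    have hc : ((k : ℝ) + 1) * (k + 1).centralBinom = 2 * (2 * k + 1) * k.centralBinom :=
      mod_cast Nat.succ_mul_centralBinom_succ k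
    push_cast
    rw [pow_succ]
    linear_combination ((1 - r ^ 2) / 4) ^ k * ((1 - r ^ 2) / 4) * hc
  convert! hd using 1
  simp at hu
  field_simp at hu ⊢
  linear_combination (-1 / 2) * hu

theorem hasSum_mul_choose_add_two_mul {r : ℝ} (h0 : 0 < r) (h1 : r < 1) (j : ℕ) :
    HasSum (fun k : ℕ => (k : ℝ) * (((j + 2 * k).choose k : ℝ) * ((1 - r ^ 2) / 4) ^ k))
      ((2 / (1 + r)) ^ j / r * (j * (1 - r) / (2 * r) + (1 - r ^ 2) / (2 * r ^ 2))) := by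
  have ht : (1 - r ^ 2) ≠ 0 := by nlinarith
  have hr : 1 + r ≠ 0 := by positivity
  induction j using Nat.twoStepInduction with
  | zero =>
    convert! hasSum_mul_centralBinom h0 h1 using 1
    · simp [Nat.centralBinom_eq_two_mul_choose]
    · simp
      field_simp
  | one =>
    convert! (((hasSum_nat_add_iff' 1).2 (hasSum_mul_centralBinom h0 h1)).mul_left
      (2 / (1 - r ^ 2))).sub (hasSum_choose_add_two_mul h0 h1 1) using 1
    · ext k
      rw [← two_mul_choose_one_add_two_mul]
      push_cast
      field_simp
      ring
    · simp
      field_simp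
      ring
  | more j ih0 ih1 =>
    convert! (((hasSum_nat_add_iff' 1).2 (ih1.sub ih0)).mul_left (4 / (1 - r ^ 2))).sub
      (hasSum_choose_add_two_mul h0 h1 (j + 2)) using 1
    · ext k
      rw [choose_add_two_add_two_mul_eq_sub]
      push_cast
      field_simp
      ring
    · simp only [pow_succ, range_one, sum_singleton]
      generalize (2 / (1 + r)) ^ j = z
      simp
      field_simp
      ring

theorem hasSum_add_mul_choose {r : ℝ} (h0 : 0 < r) (h1 : r < 1) (j : ℕ) :
    HasSum (fun k : ℕ => ((j + 2 * k).choose k : ℝ) * (j + k) * ((1 - r ^ 2) / 4) ^ k)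
      ((1 + r) / (2 * r ^ 2) * ((2 / (1 + r)) ^ j * (j + (1 - r) / r))) := by
  convert! ((hasSum_choose_add_two_mul h0 h1 j).mul_left (j : ℝ)).add
    (hasSum_mul_choose_add_two_mul h0 h1 j) using 1
  · ext k; ring
  · field_simp
    ring

theorem hasSum_natCast_add_mul_pow_div_factorial (w b : ℝ) :
    HasSum (fun j : ℕ => (j + b) * (w ^ j / j.factorial)) ((w + b) * Real.exp w) := by
  have he : HasSum (fun j : ℕ => w ^ j / j.factorial) (Real.exp w) := by
    rw [Real.exp_eq_exp_ℝ]
    exact NormedSpace.expSeries_div_hasSum_exp w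
  have hj : HasSum (fun j : ℕ => j * (w ^ j / j.factorial)) (w * Real.exp w) := by
    rw [← hasSum_nat_add_iff' 1]
    convert! he.mul_left w using 1
    · ext j
      rw [Nat.factorial_succ]
      push_cast
      field_simp
      ring
    · simp
  convert! hj.add (he.mul_left b) using 1
  · ext j; ring
  · ring

/-- The summand of the double series that is obtained by expanding `c` and setting
`m + 1 = j + 2 * k`. -/
noncomputable def doubleTerm (a y : ℝ) (p : ℕ × ℕ) : ℝ :=
  y ^ (p.1 + 2 * p.2) *
    (((p.1 + 2 * p.2).choose p.2 : ℝ) * (p.1 + p.2 : ℕ) / p.1.factorial * a ^ p.1)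

section

variable {a y r : ℝ}

theorem hasSum_doubleTerm_snd (h0 : 0 < r) (h1 : r < 1) (hy : y ^ 2 = (1 - r ^ 2) / 4) (j : ℕ) :
    HasSum (fun k => doubleTerm a y (j, k)) ((1 + r) / (2 * r ^ 2) *
      ((j + (1 - r) / r) * ((2 * y * a / (1 + r)) ^ j / j.factorial))) := by
  convert! (hasSum_add_mul_choose h0 h1 j).mul_left ((y * a) ^ j / j.factorial) using 1
  · ext k
    rw [doubleTerm, ← hy]
    push_cast
    ring
  · rw [show 2 * y * a / (1 + r) = 2 / (1 + r) * (y * a) by ring, mul_pow]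
    ring

theorem summable_doubleTerm (h0 : 0 < r) (h1 : r < 1) (hy : y ^ 2 = (1 - r ^ 2) / 4) :
    Summable (doubleTerm a y) := by
  have habs : (fun p => |doubleTerm a y p|) = doubleTerm |a| |y| := by
    ext p
    simp only [doubleTerm, abs_mul, abs_div, abs_pow, Nat.abs_cast]
  have hy' : |y| ^ 2 = (1 - r ^ 2) / 4 := by rwa [sq_abs]
  rw [← summable_abs_iff, habs, summable_prod_of_nonneg]
  · refine ⟨fun j => (hasSum_doubleTerm_snd h0 h1 hy' j).summable, ?_⟩
    simp_rw [fun j => (hasSum_doubleTerm_snd (a := |a|) h0 h1 hy' j).tsum_eq]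
    exact ((hasSum_natCast_add_mul_pow_div_factorial _ _).mul_left _).summable
  · intro p
    rw [← habs]
    exact abs_nonneg _

theorem hasSum_doubleTerm (h0 : 0 < r) (h1 : r < 1) (hy : y ^ 2 = (1 - r ^ 2) / 4) :
    HasSum (doubleTerm a y) ((1 + r) / (2 * r ^ 2) *
      ((2 * y * a / (1 + r) + (1 - r) / r) * Real.exp (2 * y * a / (1 + r)))) := by
  have hs := (summable_doubleTerm (a := a) h0 h1 hy).hasSum
  have h := hs.prod_fiberwise (hasSum_doubleTerm_snd h0 h1 hy)
  rwa [h.unique ((hasSum_natCast_add_mul_pow_div_factorial _ _).mul_left _)] at hs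

theorem hasSum_sum_range_choose (h0 : 0 < r) (h1 : r < 1) (hy : y ^ 2 = (1 - r ^ 2) / 4) :
    HasSum (fun N : ℕ => y ^ N * ∑ k ∈ range (N / 2 + 1),
        (N.choose k : ℝ) * (N - k : ℕ) / (N - 2 * k).factorial * a ^ (N - 2 * k))
      ((1 + r) / (2 * r ^ 2) *
        ((2 * y * a / (1 + r) + (1 - r) / r) * Real.exp (2 * y * a / (1 + r)))) := by
  let e : ℕ × ℕ → ℕ × ℕ := fun p => (p.1 + 2 * p.2, p.2)
  let g : ℕ × ℕ → ℝ := fun q => if 2 * q.2 ≤ q.1 then doubleTerm a y (q.1 - 2 * q.2, q.2) else 0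
  have he : Function.Injective e := by
    rintro ⟨j, k⟩ ⟨j', k'⟩ h
    simp only [e, Prod.mk.injEq] at h ⊢
    omega
  have hge : g ∘ e = doubleTerm a y := by
    ext ⟨j, k⟩
    simp [g, e]
  have hg := hasSum_doubleTerm (a := a) h0 h1 hy
  rw [← hge, he.hasSum_iff] at hg
  · refine hg.prod_fiberwise fun N => ?_
    have hN : y ^ N * ∑ k ∈ range (N / 2 + 1),
        (N.choose k : ℝ) * (N - k : ℕ) / (N - 2 * k).factorial * a ^ (N - 2 * k) =
        ∑ k ∈ range (N / 2 + 1), g (N, k) := by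
      rw [mul_sum]
      refine sum_congr rfl fun k hk => ?_
      have hk' : 2 * k ≤ N := by rw [mem_range] at hk; omega
      simp only [g, if_pos hk', doubleTerm]
      rw [show N - 2 * k + 2 * k = N by omega, show N - 2 * k + k = N - k by omega]
    rw [hN]
    refine hasSum_sum_of_ne_finset_zero fun k hk => ?_
    have hk' : ¬ 2 * k ≤ N := by rw [mem_range] at hk; omega
    simp [g, hk']
  · rintro ⟨N, k⟩ hk
    refine if_neg fun hle => hk ⟨(N - 2 * k, k), ?_⟩
    simp only [e, Prod.mk.injEq, and_true] at hle ⊢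
    omega

end

theorem c_div_rpow (n m : ℕ) (y : ℝ) (hy : y = -1 / (4 * √6 * √n)) (hn : 1 ≤ n) :
    c m / (n : ℝ) ^ ((m : ℝ) / 2) = (y * (π / 6))⁻¹ * (y ^ (m + 1) *
      ∑ k ∈ range ((m + 1) / 2 + 1), ((m + 1).choose k : ℝ) * (m + 1 - k : ℕ) /
        (m + 1 - 2 * k).factorial * (π / 6) ^ (m + 1 - 2 * k)) := by
  have hn' : (0 : ℝ) < n := by exact_mod_cast hn
  have hy0 : y ≠ 0 := by rw [hy]; positivity
  have hpow : (n : ℝ) ^ ((m : ℝ) / 2) = √n ^ m := by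
    rw [Real.sqrt_eq_rpow, ← Real.rpow_natCast, ← Real.rpow_mul hn'.le]
    ring_nf
  have hsum : ∑ k ∈ range ((m + 1) / 2 + 1), ((m + 1).choose k : ℝ) * (m + 1 - k : ℕ) /
        (m + 1 - 2 * k).factorial * (π / 6) ^ (m + 1 - 2 * k) =
      (π / 6) * ∑ k ∈ range ((m + 1) / 2 + 1), ((m + 1).choose k : ℝ) * (m + 1 - k : ℕ) /
        (m + 1 - 2 * k).factorial * (π / 6) ^ ((m : ℤ) - 2 * k) := by
    rw [mul_sum]
    refine sum_congr rfl fun k hk => ?_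
    have hk' : 2 * k ≤ m + 1 := by rw [mem_range] at hk; omega
    have hz : (π / 6) ^ (m + 1 - 2 * k) = (π / 6) * (π / 6) ^ ((m : ℤ) - 2 * k) := by
      rw [← zpow_natCast, ← zpow_one_add₀ (by positivity)]
      congr 1
      omega
    rw [hz]
    ring
  have hym : y ^ m = (-1) ^ m / (4 * √6) ^ m / √n ^ m := by
    rw [hy, div_pow, mul_pow _ (√n), div_div]
  rw [hsum, c, hpow, pow_succ, hym]
  field_simp

theorem stmt4 (n : ℕ) (hn : 1 ≤ n) :
    HasSum (fun m : ℕ => c m / (n : ℝ) ^ ((m : ℝ) / 2))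
      (24 * n / (24 * n - 1) * Real.exp (μ n - π * Real.sqrt (2 * n / 3)) * (1 - 1 / μ n)) := by
  have hn' : (1 : ℝ) ≤ n := by exact_mod_cast hn
  set q := √(24 * n - 1 : ℝ)
  set p := √(24 * n : ℝ) with hp
  have hq2 : q ^ 2 = 24 * n - 1 := Real.sq_sqrt (by linarith)
  have hp2 : p ^ 2 = 24 * n := Real.sq_sqrt (by linarith)
  have hq0 : 0 < q := Real.sqrt_pos.2 (by linarith)
  have hp0 : 0 < p := Real.sqrt_pos.2 (by linarith)
  have hqp : q < p := Real.sqrt_lt_sqrt (by linarith) (by linarith)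
  have hpn : 4 * √6 * √n = 2 * p := by
    rw [hp, show (24 * n : ℝ) = 2 ^ 2 * (6 * n) by ring, Real.sqrt_mul (by positivity),
      Real.sqrt_sq (by positivity), Real.sqrt_mul (by positivity)]
    ring
  have hpe : π * √(2 * n / 3) = π / 6 * p := by
    rw [show (2 * n / 3 : ℝ) = (p / 6) ^ 2 by rw [div_pow, hp2]; ring,
      Real.sqrt_sq (by positivity)]
    ring
  have hμ : μ n = π / 6 * q := rfl
  have h0 : 0 < q / p := by positivity
  have h1 : q / p < 1 := (div_lt_one hp0).2 hqp
  have hsq : p ^ 2 - q ^ 2 = 1 := by linarith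
  have hy : (-1 / (2 * p)) ^ 2 = (1 - (q / p) ^ 2) / 4 := by
    field_simp
    linarith
  have hN := (hasSum_nat_add_iff' 1).2 (hasSum_sum_range_choose (a := π / 6) h0 h1 hy)
  have hw : 2 * (-1 / (2 * p)) * (π / 6) / (1 + q / p) = π / 6 * q - π / 6 * p := by
    field_simp
    linear_combination hsq
  convert! hN.mul_left ((-1 / (2 * p) * (π / 6))⁻¹) using 1
  · ext m
    exact c_div_rpow n m _ (by rw [hpn]) hn
  · rw [hw, hpe, hμ, ← hq2, ← hp2]
    simp
    field_simp
    linear_combination (6 - q * π) * hsq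
end

section
/- For every integer n ≥ 1, one has |4√3 · n · exp(−π√(2n/3)) · p(n) − Σ_{m=0}^∞ c_m / n^{m/2}| ≤ exp(−(π/2)√(2n/3)). -/
open Real Finset Filter Topology

/-- The number of partitions of `n`, as a real number. -/
noncomputable def p (n : ℕ) : ℝ := (Fintype.card (Nat.Partition n) : ℝ)

/-- A solution of the linear recurrence `F j = F (j - 1) + x * F (j + 1)` which does not grow too
fast is a multiple of the geometric sequence whose ratio is the small characteristic root. -/
lemma succ_eq_root_mul_of_recurrence {x C K : ℝ} {F : ℕ → ℝ} (hC : x * C ^ 2 = C - 1)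
    (hxC : |x * C| < 1 / 4) (hF : ∀ j, F (j + 1) = F j + x * F (j + 2))
    (hK : ∀ j, |F j| ≤ K * 4 ^ j) (j : ℕ) : F (j + 1) = C * F j := by
  have step (i : ℕ) : F (i + 1) - C * F i = x * C * (F (i + 2) - C * F (i + 1)) := by
    linear_combination C * hF i + F (i + 1) * hC
  have iter (m : ℕ) : F (j + 1) - C * F j = (x * C) ^ m * (F (j + m + 1) - C * F (j + m)) := by
    induction m with
    | zero => simp
    | succ m ih => rw [ih, step (j + m)]; ring_nf
  have bound (m : ℕ) : |F (j + 1) - C * F j| ≤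
      (4 + |C|) * K * 4 ^ j * (4 * |x * C|) ^ m := by
    rw [iter m, abs_mul, abs_pow, mul_pow 4]
    have h1 : |F (j + m + 1) - C * F (j + m)| ≤ (4 + |C|) * K * 4 ^ j * 4 ^ m := by
      refine (abs_sub _ _).trans ?_
      rw [abs_mul]
      have e1 := hK (j + m + 1)
      have e2 := mul_le_mul_of_nonneg_left (hK (j + m)) (abs_nonneg C)
      calc _ ≤ K * 4 ^ (j + m + 1) + |C| * (K * 4 ^ (j + m)) := add_le_add e1 e2
        _ = _ := by ring
    calc _ ≤ |x * C| ^ m * ((4 + |C|) * K * 4 ^ j * 4 ^ m) := by gcongr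
      _ = _ := by ring
  have lim : Tendsto (fun m : ℕ ↦ (4 + |C|) * K * 4 ^ j * (4 * |x * C|) ^ m) atTop (𝓝 0) := by
    have := tendsto_pow_atTop_nhds_zero_of_lt_one (r := 4 * |x * C|) (by positivity) (by linarith)
    simpa using this.const_mul ((4 + |C|) * K * 4 ^ j)
  have h0 : |F (j + 1) - C * F j| ≤ 0 := ge_of_tendsto' lim bound
  exact sub_eq_zero.mp (abs_nonpos_iff.mp h0)

lemma eq_mul_root_pow_of_recurrence {x C K : ℝ} {F : ℕ → ℝ} (hC : x * C ^ 2 = C - 1)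
    (hxC : |x * C| < 1 / 4) (hF : ∀ j, F (j + 1) = F j + x * F (j + 2))
    (hK : ∀ j, |F j| ≤ K * 4 ^ j) (j : ℕ) : F j = F 0 * C ^ j := by
  induction j with
  | zero => simp
  | succ j ih => rw [succ_eq_root_mul_of_recurrence hC hxC hF hK, ih]; ring

lemma choose_two_mul_add_le (j k : ℕ) : ((2 * k + j).choose k : ℝ) ≤ 2 ^ j * 4 ^ k := by
  have : (2 * k + j).choose k ≤ 2 ^ (2 * k + j) := Nat.choose_le_two_pow _ _
  calc ((2 * k + j).choose k : ℝ) ≤ 2 ^ (2 * k + j) := by exact_mod_cast this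
    _ = _ := by rw [pow_add, pow_mul]; norm_num; ring

lemma weighted_choose_term_le {x : ℝ} (hx0 : 0 ≤ x) (j k : ℕ) :
    ((j : ℝ) + k) * ((2 * k + j).choose k : ℝ) * x ^ k ≤ 4 ^ j * (8 * x) ^ k := by
  have h1 : ((j : ℝ) + k) ≤ 2 ^ j * 2 ^ k := by
    rw [← pow_add]
    exact_mod_cast (Nat.lt_two_pow_self (n := j + k)).le
  calc ((j : ℝ) + k) * ((2 * k + j).choose k : ℝ) * x ^ k
      ≤ (2 ^ j * 2 ^ k) * (2 ^ j * 4 ^ k) * x ^ k := by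
        gcongr
        exact choose_two_mul_add_le j k
    _ = (2 * 2) ^ j * ((2 * 4) * x) ^ k := by simp only [mul_pow]; ring
    _ = _ := by norm_num

lemma choose_term_le {x : ℝ} (hx0 : 0 ≤ x) (j k : ℕ) :
    ((2 * k + j).choose k : ℝ) * x ^ k ≤ 4 ^ j * (8 * x) ^ k := by
  calc ((2 * k + j).choose k : ℝ) * x ^ k
      ≤ (2 ^ j * 4 ^ k) * x ^ k := by
        gcongr
        exact choose_two_mul_add_le j k
    _ ≤ (4 ^ j * 8 ^ k) * x ^ k := by gcongr <;> norm_num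
    _ = _ := by rw [mul_pow]; ring

section
variable {x : ℝ} (hx0 : 0 ≤ x) (hx1 : x ≤ 1 / 32)
include hx0 hx1

lemma summable_choose_term (j : ℕ) :
    Summable fun k : ℕ ↦ ((2 * k + j).choose k : ℝ) * x ^ k :=
  .of_nonneg_of_le (fun k ↦ by positivity) (choose_term_le hx0 j)
    ((summable_geometric_of_lt_one (by positivity) (by linarith)).mul_left _)

lemma summable_weighted_choose_term (j : ℕ) :
    Summable fun k : ℕ ↦ ((j : ℝ) + k) * ((2 * k + j).choose k : ℝ) * x ^ k :=
  .of_nonneg_of_le (fun k ↦ by positivity) (weighted_choose_term_le hx0 j)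
    ((summable_geometric_of_lt_one (by positivity) (by linarith)).mul_left _)

end

section
variable {x : ℝ} (hx0 : 0 ≤ x) (hx1 : x ≤ 1 / 32)
include hx0 hx1

lemma tsum_choose_recurrence (j : ℕ) :
    ∑' k : ℕ, ((2 * k + (j + 1)).choose k : ℝ) * x ^ k =
      (∑' k : ℕ, ((2 * k + j).choose k : ℝ) * x ^ k) +
        x * ∑' k : ℕ, ((2 * k + (j + 2)).choose k : ℝ) * x ^ k := by
  have s0 := summable_choose_term hx0 hx1 j
  have s1 := summable_choose_term hx0 hx1 (j + 1)
  have s2 := summable_choose_term hx0 hx1 (j + 2)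
  rw [s1.tsum_eq_zero_add, s0.tsum_eq_zero_add, ← tsum_mul_left, add_assoc,
    ← ((summable_nat_add_iff 1).mpr s0).tsum_add (s2.mul_left x)]
  simp only [Nat.choose_zero_right]
  congr 1
  refine tsum_congr fun k ↦ ?_
  rw [show 2 * (k + 1) + (j + 1) = (2 * k + (j + 2)) + 1 by ring, Nat.choose_succ_succ,
    show 2 * (k + 1) + j = 2 * k + (j + 2) by ring]
  push_cast
  ring

lemma tsum_centralBinom_eq :
    ∑' k : ℕ, ((2 * k + 0).choose k : ℝ) * x ^ k =
      1 + 2 * x * ∑' k : ℕ, ((2 * k + 1).choose k : ℝ) * x ^ k := by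
  rw [(summable_choose_term hx0 hx1 0).tsum_eq_zero_add, ← tsum_mul_left]
  simp only [Nat.choose_zero_right, Nat.cast_one, pow_zero, mul_one]
  congr 1
  refine tsum_congr fun k ↦ ?_
  rw [show 2 * (k + 1) + 0 = (2 * k + 1) + 1 by ring, Nat.choose_succ_succ,
    Nat.choose_symm_half]
  push_cast
  ring

lemma tsum_weighted_choose_recurrence (j : ℕ) :
    ∑' k : ℕ, (((j + 1 : ℕ) : ℝ) + k) * ((2 * k + (j + 1)).choose k : ℝ) * x ^ k =
      (∑' k : ℕ, ((j : ℝ) + k) * ((2 * k + j).choose k : ℝ) * x ^ k) +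
      (∑' k : ℕ, ((2 * k + j).choose k : ℝ) * x ^ k) +
        x * ∑' k : ℕ, (((j + 2 : ℕ) : ℝ) + k) * ((2 * k + (j + 2)).choose k : ℝ) * x ^ k := by
  have b0 := summable_choose_term hx0 hx1 j
  have s0 := summable_weighted_choose_term hx0 hx1 j
  have s1 := summable_weighted_choose_term hx0 hx1 (j + 1)
  have s2 := summable_weighted_choose_term hx0 hx1 (j + 2)
  rw [← s0.tsum_add b0, s1.tsum_eq_zero_add, (s0.add b0).tsum_eq_zero_add, ← tsum_mul_left,
    add_assoc, ← ((summable_nat_add_iff 1).mpr (s0.add b0)).tsum_add (s2.mul_left x)]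
  simp only [Nat.choose_zero_right]
  congr 1
  · simp
  refine tsum_congr fun k ↦ ?_
  rw [show 2 * (k + 1) + (j + 1) = (2 * k + (j + 2)) + 1 by ring, Nat.choose_succ_succ,
    show 2 * (k + 1) + j = 2 * k + (j + 2) by ring]
  push_cast
  ring

lemma tsum_weighted_centralBinom_eq :
    ∑' k : ℕ, (((0 : ℕ) : ℝ) + k) * ((2 * k + 0).choose k : ℝ) * x ^ k =
      2 * x * ∑' k : ℕ, (((1 : ℕ) : ℝ) + k) * ((2 * k + 1).choose k : ℝ) * x ^ k := by
  rw [(summable_weighted_choose_term hx0 hx1 0).tsum_eq_zero_add, ← tsum_mul_left]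
  simp only [Nat.cast_zero, zero_add, add_zero, zero_mul]
  refine tsum_congr fun k ↦ ?_
  rw [show 2 * (k + 1) = (2 * k + 1) + 1 by ring, Nat.choose_succ_succ,
    Nat.choose_symm_half]
  push_cast
  ring

lemma abs_tsum_choose_le (j : ℕ) :
    |∑' k : ℕ, ((2 * k + j).choose k : ℝ) * x ^ k| ≤ (1 - 8 * x)⁻¹ * 4 ^ j := by
  rw [abs_of_nonneg (tsum_nonneg fun k ↦ by positivity)]
  refine tsum_le_of_sum_range_le (fun k ↦ by positivity) fun N ↦ ?_
  have hg := (summable_geometric_of_lt_one (r := 8 * x) (by positivity) (by linarith)).mul_left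
    ((4 : ℝ) ^ j)
  calc _ ≤ ∑ k ∈ range N, (4 : ℝ) ^ j * (8 * x) ^ k :=
        Finset.sum_le_sum fun k _ ↦ choose_term_le hx0 j k
    _ ≤ ∑' k : ℕ, (4 : ℝ) ^ j * (8 * x) ^ k := hg.sum_le_tsum _ fun k _ ↦ by positivity
    _ = _ := by
      rw [tsum_mul_left, tsum_geometric_of_lt_one (by positivity) (by linarith)]; ring

lemma abs_tsum_weighted_choose_le (j : ℕ) :
    |∑' k : ℕ, ((j : ℝ) + k) * ((2 * k + j).choose k : ℝ) * x ^ k| ≤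
      (1 - 8 * x)⁻¹ * 4 ^ j := by
  rw [abs_of_nonneg (tsum_nonneg fun k ↦ by positivity)]
  refine tsum_le_of_sum_range_le (fun k ↦ by positivity) fun N ↦ ?_
  have hg := (summable_geometric_of_lt_one (r := 8 * x) (by positivity) (by linarith)).mul_left
    ((4 : ℝ) ^ j)
  calc _ ≤ ∑ k ∈ range N, (4 : ℝ) ^ j * (8 * x) ^ k :=
        Finset.sum_le_sum fun k _ ↦ weighted_choose_term_le hx0 j k
    _ ≤ ∑' k : ℕ, (4 : ℝ) ^ j * (8 * x) ^ k := hg.sum_le_tsum _ fun k _ ↦ by positivity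
    _ = _ := by
      rw [tsum_mul_left, tsum_geometric_of_lt_one (by positivity) (by linarith)]; ring

end

section
variable {r : ℝ} (hr0 : 9 / 10 ≤ r) (hr1 : r ≤ 1)
include hr0 hr1

/-- The generating function of the binomial coefficients `(2 * k + j).choose k`, at `(1 - r ^ 2) / 4`. -/
lemma tsum_choose_eq (h32 : (1 - r ^ 2) / 4 ≤ 1 / 32) (j : ℕ) :
    ∑' k : ℕ, ((2 * k + j).choose k : ℝ) * ((1 - r ^ 2) / 4) ^ k = (2 / (1 + r)) ^ j / r := by
  have hx0 : 0 ≤ (1 - r ^ 2) / 4 := by nlinarith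
  set x := (1 - r ^ 2) / 4 with hx
  have hr : r ≠ 0 := by linarith
  have hr' : 1 + r ≠ 0 := by linarith
  have hxC : x * (2 / (1 + r)) = (1 - r) / 2 := by rw [hx]; field_simp; ring
  have key := eq_mul_root_pow_of_recurrence (x := x) (C := 2 / (1 + r))
    (F := fun j ↦ ∑' k : ℕ, ((2 * k + j).choose k : ℝ) * x ^ k)
    (by rw [hx]; field_simp; ring)
    (by rw [hxC, abs_lt]; constructor <;> linarith)
    (tsum_choose_recurrence hx0 h32) (abs_tsum_choose_le hx0 h32)
  have h0 := tsum_centralBinom_eq hx0 h32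
  have h1 := key 1
  simp only [pow_one] at h1
  rw [h1] at h0
  rw [key j]
  field_simp
  rw [mul_comm]
  linear_combination h0 + 2 * (∑' k : ℕ, ((2 * k + 0).choose k : ℝ) * x ^ k) * hxC

lemma tsum_weighted_choose_eq (h32 : (1 - r ^ 2) / 4 ≤ 1 / 32) (j : ℕ) :
    ∑' k : ℕ, ((j : ℝ) + k) * ((2 * k + j).choose k : ℝ) * ((1 - r ^ 2) / 4) ^ k =
      (2 / (1 + r)) ^ j / r * (j * ((1 + r) / (2 * r)) + (1 - r ^ 2) / (2 * r ^ 2)) := by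
  have hx0 : 0 ≤ (1 - r ^ 2) / 4 := by nlinarith
  have hB := tsum_choose_eq hr0 hr1 h32
  set x := (1 - r ^ 2) / 4 with hx
  have hr : r ≠ 0 := by linarith
  have hrpos : 0 < r := by linarith
  have hr' : 1 + r ≠ 0 := by linarith
  have hxC : x * (2 / (1 + r)) = (1 - r) / 2 := by rw [hx]; field_simp; ring
  have hC2 : x * (2 / (1 + r)) ^ 2 = 2 / (1 + r) - 1 := by rw [hx]; field_simp; ring
  have key := eq_mul_root_pow_of_recurrence (x := x) (C := 2 / (1 + r))
    (F := fun j ↦ (∑' k : ℕ, ((j : ℝ) + k) * ((2 * k + j).choose k : ℝ) * x ^ k) -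
      (2 / (1 + r)) ^ j / r * (j * ((1 + r) / (2 * r)) + (1 - r ^ 2) / (2 * r ^ 2)))
    (K := (1 - 8 * x)⁻¹ + 1 / r * ((1 + r) / (2 * r) + (1 - r ^ 2) / (2 * r ^ 2)))
    hC2 (by rw [hxC, abs_lt]; constructor <;> linarith) ?_ ?_
  · have h0 := tsum_weighted_centralBinom_eq hx0 h32
    have h1 := key 1
    simp only [pow_one] at h1
    have hF0 : (∑' k : ℕ, (((0 : ℕ) : ℝ) + k) * ((2 * k + 0).choose k : ℝ) * x ^ k) -
      (2 / (1 + r)) ^ 0 / r * ((0 : ℕ) * ((1 + r) / (2 * r)) + (1 - r ^ 2) / (2 * r ^ 2)) = 0 := by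
      set S := ∑' k : ℕ, (((0 : ℕ) : ℝ) + k) * ((2 * k + 0).choose k : ℝ) * x ^ k
      rw [sub_eq_iff_eq_add] at h1
      rw [h1] at h0
      have e : 2 * x = (1 - r) * (1 + r) / 2 := by rw [hx]; ring
      rw [e] at h0
      field_simp at h0
      push_cast at h0
      have h3 : r * (2 * S * r ^ 3 - (1 - r ^ 2)) = 0 := by linear_combination h0
      have h4 : 2 * S * r ^ 3 - (1 - r ^ 2) = 0 := by simpa [hr] using h3
      field_simp
      push_cast
      linear_combination h4
    have := key j
    rw [hF0, zero_mul] at this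
    linarith
  · intro j
    have hE := tsum_weighted_choose_recurrence hx0 h32 j
    have h1 : (2 / (1 + r)) ^ (j + 1) * (1 + r) = 2 * (2 / (1 + r)) ^ j := by
      rw [pow_succ]; field_simp
    rw [hE, hB j]
    have h2 : x * (2 / (1 + r)) ^ (j + 2) = (2 / (1 + r)) ^ j * (2 / (1 + r) - 1) := by
      rw [pow_add, ← hC2]; ring
    rw [mul_sub x, ← mul_assoc x, mul_div_assoc' x, h2, pow_succ]
    push_cast
    field_simp
    ring
  · intro j
    refine (abs_sub _ _).trans ?_
    rw [add_mul]
    refine add_le_add (abs_tsum_weighted_choose_le hx0 h32 j) ?_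
    have hC : 2 / (1 + r) ≤ 2 := by rw [div_le_iff₀ (by linarith)]; linarith
    have h1r : 0 ≤ 1 - r ^ 2 := by nlinarith
    rw [abs_of_nonneg (by positivity)]
    have hj : (j : ℝ) ≤ 2 ^ j := by exact_mod_cast (Nat.lt_two_pow_self (n := j)).le
    have hj1 : (1 : ℝ) ≤ 2 ^ j := one_le_pow₀ (by norm_num)
    calc (2 / (1 + r)) ^ j / r * (j * ((1 + r) / (2 * r)) + (1 - r ^ 2) / (2 * r ^ 2))
        ≤ 2 ^ j / r * (2 ^ j * ((1 + r) / (2 * r)) + 2 ^ j * ((1 - r ^ 2) / (2 * r ^ 2))) := by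
          gcongr
          exact le_mul_of_one_le_left (by positivity) hj1
      _ = _ := by
        rw [show (4 : ℝ) = 2 * 2 by norm_num, mul_pow]; ring

end

lemma hasSum_tsum_rearranged {α t r : ℝ} (hr0 : 9 / 10 ≤ r) (hr1 : r ≤ 1)
    (ht : t ^ 2 = (1 - r ^ 2) / 4) (h32 : (1 - r ^ 2) / 4 ≤ 1 / 32) :
    HasSum (fun m : ℕ ↦ ∑ k ∈ range (m / 2 + 1),
      (α * t) ^ (m - 2 * k) / (m - 2 * k).factorial *
        (((m - 2 * k : ℕ) + (k : ℝ)) * ((2 * k + (m - 2 * k)).choose k : ℝ) * (t ^ 2) ^ k))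
      (Real.exp (α * t * (2 / (1 + r))) / r *
        (α * t * (2 / (1 + r)) * ((1 + r) / (2 * r)) + (1 - r ^ 2) / (2 * r ^ 2))) := by
  set H : ℕ × ℕ → ℝ := fun q ↦ (α * t) ^ q.1 / q.1.factorial *
    (((q.1 : ℕ) + (q.2 : ℝ)) * ((2 * q.2 + q.1).choose q.2 : ℝ) * (t ^ 2) ^ q.2) with hH
  have ht0 : 0 ≤ t ^ 2 := sq_nonneg t
  have hsum : Summable H := by
    have h1 : Summable fun j : ℕ ↦ (4 * |α * t|) ^ j / j.factorial :=
      Real.summable_pow_div_factorial _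
    have h2 : Summable fun k : ℕ ↦ (8 * t ^ 2) ^ k :=
      summable_geometric_of_lt_one (by positivity) (by linarith)
    refine Summable.of_norm_bounded
      (h1.mul_of_nonneg h2 (fun j ↦ by positivity) fun k ↦ by positivity) fun q ↦ ?_
    rw [hH, Real.norm_eq_abs, abs_mul, abs_div, abs_pow,
      abs_of_nonneg (show (0 : ℝ) ≤ q.1.factorial by positivity),
      abs_of_nonneg (show (0 : ℝ) ≤ ((q.1 : ℕ) + (q.2 : ℝ)) *
        ((2 * q.2 + q.1).choose q.2 : ℝ) * (t ^ 2) ^ q.2 by positivity)]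
    calc _ ≤ |α * t| ^ q.1 / q.1.factorial * (4 ^ q.1 * (8 * t ^ 2) ^ q.2) := by
          exact mul_le_mul_of_nonneg_left (weighted_choose_term_le ht0 _ _) (by positivity)
      _ = _ := by rw [mul_pow 4]; ring
  have hval : HasSum H (Real.exp (α * t * (2 / (1 + r))) / r *
        (α * t * (2 / (1 + r)) * ((1 + r) / (2 * r)) + (1 - r ^ 2) / (2 * r ^ 2))) := by
    have hfib := hsum.hasSum.prod_fiberwise (fun j ↦ (hsum.prod_factor j).hasSum)
    have hr : r ≠ 0 := by linarith
    set z := α * t * (2 / (1 + r)) with hz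
    have hinner (j : ℕ) : ∑' k, H (j, k) =
        z ^ j / j.factorial * (1 / r * (j * ((1 + r) / (2 * r)) + (1 - r ^ 2) / (2 * r ^ 2))) := by
      simp only [hH]
      rw [tsum_mul_left, ht, tsum_weighted_choose_eq hr0 hr1 h32, hz, mul_pow (α * t)]
      ring
    have hexp : HasSum (fun j : ℕ ↦ z ^ j / j.factorial) (Real.exp z) := by
      rw [Real.exp_eq_exp_ℝ]
      exact NormedSpace.expSeries_div_hasSum_exp z
    have hexp1 : HasSum (fun j : ℕ ↦ z ^ j / j.factorial * j) (z * Real.exp z) := by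
      rw [← hasSum_nat_add_iff' 1]
      simp only [range_one, sum_singleton, Nat.cast_zero, mul_zero, sub_zero]
      refine (hexp.mul_left z).congr_fun fun j ↦ ?_
      rw [Nat.factorial_succ, pow_succ]
      push_cast
      field_simp
    have h3 := (hexp1.mul_left (1 / r * ((1 + r) / (2 * r)))).add
      (hexp.mul_left (1 / r * ((1 - r ^ 2) / (2 * r ^ 2))))
    have h4 : (fun j ↦ ∑' k, H (j, k)) = fun j : ℕ ↦
        1 / r * ((1 + r) / (2 * r)) * (z ^ j / j.factorial * j) +
          1 / r * ((1 - r ^ 2) / (2 * r ^ 2)) * (z ^ j / j.factorial) := by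
      ext j
      rw [hinner]
      ring
    rw [h4] at hfib
    have := hfib.unique h3
    have hS := hsum.hasSum
    rw [this] at hS
    convert hS using 1
    ring
  let e : ℕ × ℕ → ℕ × ℕ := fun q ↦ (q.1 + 2 * q.2, q.2)
  have he : Function.Injective e := by
    rintro ⟨a, b⟩ ⟨a', b'⟩ h
    simp only [e, Prod.mk.injEq] at h ⊢
    omega
  set H2 : ℕ × ℕ → ℝ := fun q ↦ if 2 * q.2 ≤ q.1 then H (q.1 - 2 * q.2, q.2) else 0 with hH2
  have hcomp : H2 ∘ e = H := by
    ext ⟨a, b⟩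
    simp [hH2, e]
  have h2 : HasSum H2 _ := (he.hasSum_iff (fun q hq ↦ by
    simp only [hH2]
    rw [if_neg]
    contrapose! hq
    exact ⟨(q.1 - 2 * q.2, q.2), by simp [e, Nat.sub_add_cancel hq]⟩)).mp (by rwa [hcomp])
  refine h2.prod_fiberwise fun m ↦ ?_
  have : ∑ k ∈ range (m / 2 + 1), (α * t) ^ (m - 2 * k) / (m - 2 * k).factorial *
        (((m - 2 * k : ℕ) + (k : ℝ)) * ((2 * k + (m - 2 * k)).choose k : ℝ) * (t ^ 2) ^ k) =
      ∑ k ∈ range (m / 2 + 1), H2 (m, k) := by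
    refine Finset.sum_congr rfl fun k hk ↦ ?_
    rw [Finset.mem_range] at hk
    simp only [hH2, hH]
    rw [if_pos (by omega)]
  rw [this]
  refine hasSum_sum_of_ne_finset_zero fun k hk ↦ ?_
  rw [Finset.mem_range] at hk
  simp only [hH2]
  rw [if_neg (by omega)]

lemma c_term_eq {n : ℕ} (hn : 1 ≤ n) (m : ℕ) {t : ℝ} (ht : t = -(1 / (4 * √6 * √n))) :
    π / 6 * t * (c m / (n : ℝ) ^ ((m : ℝ) / 2)) = ∑ k ∈ range ((m + 1) / 2 + 1),
      (π / 6 * t) ^ (m + 1 - 2 * k) / (m + 1 - 2 * k).factorial *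
        (((m + 1 - 2 * k : ℕ) + (k : ℝ)) * ((2 * k + (m + 1 - 2 * k)).choose k : ℝ) *
          (t ^ 2) ^ k) := by
  have hn0 : (0 : ℝ) < n := by exact_mod_cast hn
  have hpow : (-1 : ℝ) ^ m / (4 * √6) ^ m / (n : ℝ) ^ ((m : ℝ) / 2) = t ^ m := by
    rw [Real.rpow_div_two_eq_sqrt _ hn0.le, Real.rpow_natCast, ht, ← div_pow, ← div_pow]
    congr 1
    field_simp
  calc π / 6 * t * (c m / (n : ℝ) ^ ((m : ℝ) / 2))
      = π / 6 * t * (((-1 : ℝ) ^ m / (4 * √6) ^ m / (n : ℝ) ^ ((m : ℝ) / 2)) *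
          ∑ k ∈ Finset.range ((m + 1) / 2 + 1),
            ((m + 1).choose k : ℝ) * ((m + 1 - k : ℕ) : ℝ) / ((m + 1 - 2 * k).factorial : ℝ) *
              (π / 6) ^ ((m : ℤ) - 2 * k)) := by
        rw [c]; ring
    _ = _ := by
      rw [hpow, Finset.mul_sum, Finset.mul_sum]
      refine Finset.sum_congr rfl fun k hk ↦ ?_
      rw [Finset.mem_range] at hk
      obtain ⟨j, hj⟩ : ∃ j, m + 1 = j + 2 * k := ⟨m + 1 - 2 * k, by omega⟩
      have e1 : m + 1 - 2 * k = j := by omega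
      have e2 : m + 1 - k = j + k := by omega
      rw [e1, e2, show 2 * k + j = m + 1 by omega]
      have e3 : π / 6 * (π / 6) ^ ((m : ℤ) - 2 * k) = (π / 6) ^ j := by
        rw [← zpow_one_add₀ (by positivity), ← zpow_natCast]
        congr 1
        omega
      have e4 : t * t ^ m = t ^ j * (t ^ 2) ^ k := by
        rw [← pow_succ', hj, pow_add, pow_mul]
      rw [mul_pow, ← e3]
      push_cast
      linear_combination (((m + 1).choose k : ℝ) * (j + k) / j.factorial) *
        (π / 6 * (π / 6) ^ ((m : ℤ) - 2 * k)) * e4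

/-- Closed form of the asymptotic series. -/
lemma tsum_c_eq {n : ℕ} (hn : 1 ≤ n) :
    ∑' m : ℕ, c m / (n : ℝ) ^ ((m : ℝ) / 2) =
      24 * n / (24 * n - 1) * (1 - 1 / (π * √(24 * n - 1) / 6)) *
        Real.exp (π * √(24 * n - 1) / 6 - π * √(24 * n) / 6) := by
  have hn1 : (1 : ℝ) ≤ n := by exact_mod_cast hn
  have hn0 : (0 : ℝ) < n := by linarith
  set t : ℝ := -(1 / (4 * √6 * √n)) with ht
  set W : ℝ := √(24 * n) with hW
  set U : ℝ := √(24 * n - 1) with hU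
  have hW0 : 0 < W := Real.sqrt_pos.mpr (by linarith)
  have hU0 : 0 < U := Real.sqrt_pos.mpr (by linarith)
  have hW2 : W ^ 2 = 24 * n := Real.sq_sqrt (by linarith)
  have hU2 : U ^ 2 = 24 * n - 1 := Real.sq_sqrt (by linarith)
  have htW : t = -(1 / (2 * W)) := by
    rw [ht, hW, show (24 : ℝ) * n = 2 ^ 2 * (6 * n) by ring, Real.sqrt_mul (by norm_num),
      Real.sqrt_sq (by norm_num), Real.sqrt_mul (by norm_num)]
    congr 2
    ring
  set r := U / W with hr
  have hr2 : r ^ 2 = 1 - 1 / (24 * n) := by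
    rw [hr, div_pow, hW2, hU2]; field_simp
  have hinv : 1 / (24 * (n : ℝ)) ≤ 1 / 24 := by
    apply one_div_le_one_div_of_le <;> linarith
  have hinv0 : 0 < 1 / (24 * (n : ℝ)) := by positivity
  have hrpos : 0 < r := by positivity
  have hr0 : 9 / 10 ≤ r := by nlinarith
  have hr1 : r ≤ 1 := by nlinarith
  have ht2 : t ^ 2 = (1 - r ^ 2) / 4 := by
    rw [htW, hr2, neg_sq, div_pow, mul_pow, hW2]; field_simp; ring
  have key := hasSum_tsum_rearranged (α := π / 6) hr0 hr1 ht2 (by rw [hr2]; linarith)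
  rw [← hasSum_nat_add_iff' 1] at key
  simp only [range_one, sum_singleton] at key
  have key2 := key.congr_fun (fun m ↦ c_term_eq hn m ht)
  have ht0 : t ≠ 0 := by rw [htW]; simp [hW0.ne']
  have h6 : π / 6 * t ≠ 0 := mul_ne_zero (by positivity) ht0
  have hres := (key2.mul_left (π / 6 * t)⁻¹).tsum_eq
  simp only [inv_mul_cancel_left₀ h6] at hres
  rw [hres]
  have hWU : W ^ 2 - U ^ 2 = 1 := by rw [hW2, hU2]; ring
  have hz : π / 6 * t * (2 / (1 + r)) = π * U / 6 - π * W / 6 := by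
    rw [htW, hr]
    field_simp
    linear_combination hWU
  have hn' : 24 * (n : ℝ) / (24 * n - 1) = W ^ 2 / U ^ 2 := by rw [hW2, hU2]
  rw [hz, hn']
  have hr2' : 1 - r ^ 2 = 1 / W ^ 2 := by rw [hr2, hW2]; ring
  rw [hr2', htW, hr]
  have e1 : (π * U / 6 - π * W / 6) * ((1 + U / W) / (2 * (U / W))) = -(π / (12 * U)) := by
    field_simp
    linear_combination -12 * hWU
  rw [e1]
  simp only [Nat.zero_div, zero_add, range_one, sum_singleton, mul_zero, Nat.sub_zero, Nat.cast_zero,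
    zero_mul, sub_zero]
  field_simp
  ring

section
open PowerSeries PowerSeries.WithPiTopology

lemma mk_card_restricted_le_mul_prod (K : ℕ) :
    (PowerSeries.mk fun n ↦ (#(Nat.Partition.restricted n (· ≤ K)) : ℂ)) *
      ∏ i ∈ range K, (1 - X ^ (i + 1)) = 1 := by
  rw [Nat.Partition.powerSeriesMk_card_restricted_eq_tprod, tprod_eq_prod (s := range K),
    ← Finset.prod_mul_distrib]
  · refine Finset.prod_eq_one fun i hi ↦ ?_
    rw [Finset.mem_range] at hi
    rw [if_pos (by omega)]
    simp_rw [pow_mul]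
    exact tsum_pow_mul_one_sub_of_constantCoeff_eq_zero (by simp)
  · intro i hi
    rw [Finset.mem_range] at hi
    rw [if_neg (by omega)]

lemma mk_dvd_mul_one_sub {m : ℕ} (hm : 0 < m) :
    (PowerSeries.mk fun n ↦ if m ∣ n then (1 : ℂ) else 0) * (1 - X ^ m) = 1 := by
  ext n
  rw [mul_sub, mul_one, map_sub, PowerSeries.coeff_mk, PowerSeries.coeff_mul_X_pow',
    PowerSeries.coeff_one]
  rcases le_or_gt m n with h | h
  · rw [if_pos h, PowerSeries.coeff_mk, if_neg (by omega : n ≠ 0)]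
    simp only [Nat.dvd_sub_self_right]
    by_cases h2 : m ∣ n
    · simp [h2]
    · simpa [h2] using lt_of_le_of_ne h (by rintro rfl; exact h2 dvd_rfl)
  · rw [if_neg (by omega : ¬ m ≤ n), sub_zero]
    rcases Nat.eq_zero_or_pos n with rfl | h0
    · simp
    · rw [if_neg (Nat.not_dvd_of_pos_of_lt h0 h), if_neg h0.ne']

lemma card_restricted_le_succ (K n : ℕ) :
    (#(Nat.Partition.restricted n (· ≤ K + 1)) : ℂ) =
      ∑ x ∈ antidiagonal n, (#(Nat.Partition.restricted x.1 (· ≤ K)) : ℂ) *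
        (if K + 1 ∣ x.2 then (1 : ℂ) else 0) := by
  have h1 := mk_card_restricted_le_mul_prod K
  have h2 := mk_card_restricted_le_mul_prod (K + 1)
  have h3 := mk_dvd_mul_one_sub K.succ_pos
  rw [Finset.prod_range_succ] at h2
  have key : (PowerSeries.mk fun n ↦ (#(Nat.Partition.restricted n (· ≤ K + 1)) : ℂ)) =
      (PowerSeries.mk fun n ↦ (#(Nat.Partition.restricted n (· ≤ K)) : ℂ)) *
        (PowerSeries.mk fun n ↦ if K + 1 ∣ n then (1 : ℂ) else 0) := by
    set A := PowerSeries.mk fun n ↦ (#(Nat.Partition.restricted n (· ≤ K + 1)) : ℂ)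
    set B := PowerSeries.mk fun n ↦ (#(Nat.Partition.restricted n (· ≤ K)) : ℂ)
    set T := PowerSeries.mk fun n ↦ if K + 1 ∣ n then (1 : ℂ) else 0
    set Q : ℂ⟦X⟧ := ∏ i ∈ range K, (1 - X ^ (i + 1))
    calc A = A * (B * Q) * (T * (1 - X ^ (K + 1))) := by rw [h1, h3]; ring
      _ = (A * (Q * (1 - X ^ (K + 1)))) * (B * T) := by ring
      _ = B * T := by rw [h2, one_mul]
  have := congrArg (PowerSeries.coeff n) key
  rw [PowerSeries.coeff_mul] at this
  simpa only [PowerSeries.coeff_mk] using this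

end

lemma hasSum_ite_dvd {q : ℂ} (hq : ‖q‖ < 1) {m : ℕ} (hm : 0 < m) :
    HasSum (fun n : ℕ ↦ (if m ∣ n then (1 : ℂ) else 0) * q ^ n) (1 - q ^ m)⁻¹ := by
  have hinj : Function.Injective fun j : ℕ ↦ m * j := fun a b h ↦ Nat.eq_of_mul_eq_mul_left hm h
  refine (hinj.hasSum_iff fun n hn ↦ ?_).mp ?_
  · rw [if_neg, zero_mul]
    rintro ⟨j, rfl⟩
    exact hn ⟨j, rfl⟩
  · have hqm : ‖q ^ m‖ < 1 := by
      rw [norm_pow]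
      exact pow_lt_one₀ (norm_nonneg _) hq hm.ne'
    refine (hasSum_geometric_of_norm_lt_one hqm).congr_fun fun j ↦ ?_
    simp [pow_mul]

lemma hasSum_card_restricted_le {q : ℂ} (hq : ‖q‖ < 1) (K : ℕ) :
    HasSum (fun n : ℕ ↦ (#(Nat.Partition.restricted n (· ≤ K)) : ℂ) * q ^ n)
      (∏ i ∈ range K, (1 - q ^ (i + 1)))⁻¹ := by
  induction K with
  | zero =>
    have h := mk_card_restricted_le_mul_prod 0
    simp only [range_zero, prod_empty, mul_one] at h
    have h' (n : ℕ) : (#(Nat.Partition.restricted n (· ≤ 0)) : ℂ) = if n = 0 then 1 else 0 := by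
      have := congrArg (PowerSeries.coeff n) h
      rwa [PowerSeries.coeff_mk, PowerSeries.coeff_one] at this
    simp only [h', range_zero, prod_empty, inv_one]
    convert hasSum_ite_eq (0 : ℕ) (1 : ℂ) using 2 with n
    by_cases hn : n = 0 <;> simp [hn]
  | succ K ih =>
    have hT := hasSum_ite_dvd hq K.succ_pos
    have s1 := summable_norm_iff.mpr ih.summable
    have s2 := summable_norm_iff.mpr hT.summable
    have hs := summable_norm_sum_mul_antidiagonal_of_summable_norm s1 s2
    have hv := tsum_mul_tsum_eq_tsum_sum_antidiagonal_of_summable_norm s1 s2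
    rw [ih.tsum_eq, hT.tsum_eq, ← mul_inv, ← Finset.prod_range_succ (fun i ↦ 1 - q ^ (i + 1))] at hv
    rw [hv]
    refine hs.of_norm.hasSum.congr_fun fun n ↦ ?_
    rw [card_restricted_le_succ, Finset.sum_mul]
    refine Finset.sum_congr rfl fun x hx ↦ ?_
    rw [← mem_antidiagonal.mp hx, pow_add]
    ring

lemma restricted_le_eq_univ {n K : ℕ} (h : n ≤ K) :
    Nat.Partition.restricted n (· ≤ K) = univ := by
  ext x
  simp only [Nat.Partition.restricted, mem_filter, mem_univ, true_and, iff_true]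
  exact fun i hi ↦ (x.le_of_mem_parts hi).trans h

lemma summable_card_partition {r : ℝ} (hr0 : 0 ≤ r) (hr : r < 1) :
    Summable fun n : ℕ ↦ (Fintype.card (Nat.Partition n) : ℝ) * r ^ n := by
  have hq : ‖(r : ℂ)‖ < 1 := by simpa [abs_of_nonneg hr0] using hr
  have hconv := (ModularForm.multipliable_one_sub_pow hq).hasProd.tendsto_prod_nat
  have hne : ∏' n : ℕ, (1 - (r : ℂ) ^ (n + 1)) ≠ 0 := by
    refine tprod_one_add_ne_zero_of_summable (f := fun n ↦ -(r : ℂ) ^ (n + 1)) ?_ ?_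
    · intro i h
      have h' : (r : ℂ) ^ (i + 1) = 1 := by linear_combination -h
      have := congrArg norm h'
      rw [norm_pow, norm_one] at this
      exact (pow_lt_one₀ (norm_nonneg _) hq i.succ_ne_zero).ne this
    · simpa using (summable_nat_add_iff 1).mpr
        (summable_geometric_of_lt_one (norm_nonneg _) hq)
  obtain ⟨M, hM⟩ := ((hconv.inv₀ hne).norm).bddAbove_range
  refine summable_of_sum_range_le (c := M) (fun n ↦ by positivity) fun N ↦ ?_
  have hs := hasSum_card_restricted_le hq N
  have hre : HasSum (fun n : ℕ ↦ (#(Nat.Partition.restricted n (· ≤ N)) : ℝ) * r ^ n)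
      (∏ i ∈ range N, (1 - (r : ℂ) ^ (i + 1)))⁻¹.re := by
    refine (Complex.hasSum_re hs).congr_fun fun n ↦ ?_
    norm_cast
  calc ∑ n ∈ range N, (Fintype.card (Nat.Partition n) : ℝ) * r ^ n
      = ∑ n ∈ range N, (#(Nat.Partition.restricted n (· ≤ N)) : ℝ) * r ^ n := by
        refine Finset.sum_congr rfl fun n hn ↦ ?_
        rw [restricted_le_eq_univ (Finset.mem_range.mp hn).le, Finset.card_univ]
    _ ≤ _ := sum_le_hasSum _ (fun n _ ↦ by positivity) hre
    _ ≤ ‖(∏ i ∈ range N, (1 - (r : ℂ) ^ (i + 1)))⁻¹‖ := Complex.re_le_norm _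
    _ ≤ M := hM ⟨N, rfl⟩

/-- Euler's generating function of the partition numbers, on the open unit disc. -/
theorem hasSum_card_partition {q : ℂ} (hq : ‖q‖ < 1) :
    HasSum (fun n : ℕ ↦ (Fintype.card (Nat.Partition n) : ℂ) * q ^ n)
      (∏' n : ℕ, (1 - q ^ (n + 1)))⁻¹ := by
  have hsum := summable_card_partition (norm_nonneg q) hq
  have hS : Summable fun n : ℕ ↦ (Fintype.card (Nat.Partition n) : ℂ) * q ^ n :=
    .of_norm (by simpa using hsum)
  have hne : ∏' n : ℕ, (1 - q ^ (n + 1)) ≠ 0 := by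
    refine tprod_one_add_ne_zero_of_summable (f := fun n ↦ -q ^ (n + 1)) ?_ ?_
    · intro i h
      have h' : q ^ (i + 1) = 1 := by linear_combination -h
      have := congrArg norm h'
      rw [norm_pow, norm_one] at this
      exact (pow_lt_one₀ (norm_nonneg _) hq i.succ_ne_zero).ne this
    · simpa using (summable_nat_add_iff 1).mpr
        (summable_geometric_of_lt_one (norm_nonneg _) hq)
  have hconv := (ModularForm.multipliable_one_sub_pow hq).hasProd.tendsto_prod_nat.inv₀ hne
  have hdom : Tendsto (fun K : ℕ ↦ ∑' n : ℕ,
      (#(Nat.Partition.restricted n (· ≤ K)) : ℂ) * q ^ n) atTop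
      (𝓝 (∑' n : ℕ, (Fintype.card (Nat.Partition n) : ℂ) * q ^ n)) := by
    refine tendsto_tsum_of_dominated_convergence hsum (fun n ↦ ?_) (.of_forall fun K n ↦ ?_)
    · refine tendsto_const_nhds.congr' ?_
      filter_upwards [eventually_ge_atTop n] with K hK
      rw [restricted_le_eq_univ hK, Finset.card_univ]
    · rw [norm_mul, norm_pow, Complex.norm_natCast]
      gcongr
      exact Finset.card_le_univ _
  simp_rw [fun K ↦ (hasSum_card_restricted_le hq K).tsum_eq] at hdom
  rw [tendsto_nhds_unique hconv hdom]
  exact hS.hasSum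

lemma card_partition_le (n : ℕ) : Fintype.card (Nat.Partition n) ≤ 2 ^ (n - 1) := by
  rw [← composition_card]
  exact Fintype.card_le_of_surjective _ Nat.Partition.ofComposition_surj

/-- The Euler product `∏ (1 - q ^ (n + 1))⁻¹` at `q = exp (2 π i τ)`. -/
noncomputable def partitionProd (τ : ℂ) : ℂ :=
  (∏' n : ℕ, (1 - Complex.exp (2 * π * Complex.I * τ) ^ (n + 1)))⁻¹

lemma norm_exp_two_pi_I_mul (τ : ℂ) :
    ‖Complex.exp (2 * π * Complex.I * τ)‖ = Real.exp (-(2 * π * τ.im)) := by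
  rw [Complex.norm_exp]
  congr 1
  simp

lemma hasSum_partitionProd {τ : ℂ} (hτ : 0 < τ.im) :
    HasSum (fun n : ℕ ↦ (Fintype.card (Nat.Partition n) : ℂ) *
      Complex.exp (2 * π * Complex.I * τ) ^ n) (partitionProd τ) := by
  refine hasSum_card_partition ?_
  rw [norm_exp_two_pi_I_mul, Real.exp_lt_one_iff]
  have : 0 < 2 * π * τ.im := by positivity
  linarith

lemma eta_inv_eq (τ : ℂ) :
    (ModularForm.eta τ)⁻¹ = Complex.exp (-(π * Complex.I / 12 * τ)) * partitionProd τ := by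
  rw [ModularForm.eta, mul_inv, partitionProd]
  congr 1
  · rw [Function.Periodic.qParam, ← Complex.exp_neg]
    congr 1
    push_cast
    ring
  · simp_rw [ModularForm.eta_q_eq_pow]

lemma norm_partitionProd_sub_one_le {τ : ℂ} (hτ : 0 < τ.im)
    (h : Real.exp (-(2 * π * τ.im)) < 1 / 2) :
    ‖partitionProd τ - 1‖ ≤
      Real.exp (-(2 * π * τ.im)) / (1 - 2 * Real.exp (-(2 * π * τ.im))) := by
  set r := Real.exp (-(2 * π * τ.im)) with hr
  have hr0 : 0 ≤ r := (Real.exp_pos _).le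
  have hs := hasSum_partitionProd hτ
  rw [← hasSum_nat_add_iff' 1] at hs
  simp only [range_one, sum_singleton, pow_zero, mul_one, Fintype.card_unique, Nat.cast_one] at hs
  have hg := (hasSum_geometric_of_lt_one (r := 2 * r) (by positivity) (by linarith)).mul_left r
  rw [← hs.tsum_eq]
  refine (tsum_of_norm_bounded hg fun n ↦ ?_).trans (by rw [div_eq_mul_inv])
  rw [norm_mul, norm_pow, norm_exp_two_pi_I_mul, ← hr, Complex.norm_natCast]
  have : (Fintype.card (Nat.Partition (n + 1)) : ℝ) ≤ 2 ^ n := by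
    exact_mod_cast card_partition_le (n + 1)
  calc _ ≤ (2 : ℝ) ^ n * r ^ (n + 1) := by gcongr
    _ = _ := by rw [mul_pow]; ring

lemma exp_neg_two_pi_mul_le {y : ℝ} (hy0 : 0 < y) (hy : 3 ≤ 4 * y ^ 2) :
    Real.exp (-(2 * π * y)) ≤ 1 / 220 := by
  have h1 : (0.866 : ℝ) ≤ y := by nlinarith
  have h2 : (5.4 : ℝ) ≤ 2 * π * y := by nlinarith [Real.pi_gt_d2]
  have h3 : (220 : ℝ) ≤ Real.exp 5.4 := by
    have e1 : Real.exp 5.4 = Real.exp 1 ^ 5 * Real.exp 0.4 := by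
      rw [← Real.exp_nat_mul, ← Real.exp_add]; norm_num
    have e2 : (1.48 : ℝ) + 0.01 ≤ Real.exp 0.4 := by
      have := Real.sum_le_exp_of_nonneg (x := 0.4) (by norm_num) 4
      norm_num [Finset.sum_range_succ, Nat.factorial] at this ⊢
      linarith
    have e3 : (2.718 : ℝ) ^ 5 ≤ Real.exp 1 ^ 5 := by
      gcongr
      linarith [Real.exp_one_gt_d9]
    rw [e1]
    calc (220 : ℝ) ≤ 2.718 ^ 5 * (1.48 + 0.01) := by norm_num
      _ ≤ _ := by gcongr
  rw [Real.exp_neg, ← one_div]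
  exact one_div_le_one_div_of_le (by norm_num) (h3.trans (Real.exp_le_exp.mpr h2))

lemma norm_partitionProd_sub_one_le_of_large {τ : ℂ} (hτ : 0 < τ.im) (h : 3 ≤ 4 * τ.im ^ 2) :
    ‖partitionProd τ - 1‖ ≤ 1.01 * Real.exp (-(2 * π * τ.im)) := by
  have h1 := exp_neg_two_pi_mul_le hτ h
  refine (norm_partitionProd_sub_one_le hτ (by linarith)).trans ?_
  rw [div_le_iff₀ (by linarith)]
  nlinarith [Real.exp_pos (-(2 * π * τ.im))]

lemma norm_eta_inv_le_of_large {τ : ℂ} (hτ : 0 < τ.im) (h : 3 ≤ 4 * τ.im ^ 2) :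
    ‖(ModularForm.eta τ)⁻¹‖ ≤ 1.005 * Real.exp (π / 12 * τ.im) := by
  rw [eta_inv_eq, norm_mul, mul_comm]
  have h1 := exp_neg_two_pi_mul_le hτ h
  have h2 := norm_partitionProd_sub_one_le_of_large hτ h
  have h3 : ‖partitionProd τ‖ ≤ 1.005 := by
    calc ‖partitionProd τ‖ = ‖(partitionProd τ - 1) + 1‖ := by ring_nf
      _ ≤ ‖partitionProd τ - 1‖ + ‖(1 : ℂ)‖ := norm_add_le _ _
      _ ≤ 1.005 := by rw [norm_one]; norm_num at h2 ⊢; linarith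
  have h4 : ‖Complex.exp (-(π * Complex.I / 12 * τ))‖ = Real.exp (π / 12 * τ.im) := by
    rw [Complex.norm_exp]
    congr 1
    simp
  rw [h4]
  gcongr

open scoped MatrixGroups UpperHalfPlane in
lemma norm_eta_inv_eq (γ : SL(2, ℤ)) (τ : ℍ) :
    ‖(ModularForm.eta τ)⁻¹‖ =
      √‖UpperHalfPlane.denom γ τ‖ * ‖(ModularForm.eta (γ • τ : ℍ))⁻¹‖ := by
  have h := congrFun (_root_.SlashInvariantForm.slash_action_generators_SL2Z ModularForm.discriminant_S_invariant
    ModularForm.discriminant_T_invariant γ) τ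
  rw [ModularForm.SL_slash_apply] at h
  have hd : UpperHalfPlane.denom γ τ ≠ 0 := UpperHalfPlane.denom_ne_zero _ _
  simp only [ModularForm.discriminant] at h
  have h2 := congrArg norm h
  rw [norm_mul, norm_pow, norm_pow, norm_zpow] at h2
  set D := ‖UpperHalfPlane.denom γ τ‖ with hD
  have hD0 : 0 < D := norm_pos_iff.mpr hd
  have e1 : ‖ModularForm.eta (γ • τ : ℍ)‖ = √D * ‖ModularForm.eta τ‖ := by
    have hs : √D ^ 24 = D ^ 12 := by
      rw [show 24 = 2 * 12 by norm_num, pow_mul, Real.sq_sqrt hD0.le]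
    refine (pow_left_inj₀ (norm_nonneg _) (by positivity) (n := 24) (by norm_num)).mp ?_
    rw [mul_pow, hs, ← h2]
    rw [show (-12 : ℤ) = -((12 : ℕ) : ℤ) by norm_num, zpow_neg, zpow_natCast]
    field_simp
  have hs0 : √D ≠ 0 := (Real.sqrt_pos.mpr hD0).ne'
  rw [norm_inv, norm_inv, e1, mul_inv, mul_inv_cancel_left₀ hs0]

open scoped MatrixGroups UpperHalfPlane in
/-- Moving `τ` into the standard fundamental domain to bound `1 / η`. -/
lemma exists_norm_eta_inv_le {τ : ℂ} (hτ : 0 < τ.im) :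
    ∃ c d : ℤ, IsCoprime c d ∧ 3 ≤ 4 * (τ.im / Complex.normSq (c * τ + d)) ^ 2 ∧
      ‖(ModularForm.eta τ)⁻¹‖ ≤ 1.005 * √‖(c * τ + d : ℂ)‖ *
        Real.exp (π / 12 * (τ.im / Complex.normSq (c * τ + d))) := by
  obtain ⟨γ, hγ⟩ := ModularGroup.exists_smul_mem_fd ⟨τ, hτ⟩
  set z : ℍ := ⟨τ, hτ⟩
  have hden : UpperHalfPlane.denom γ z = (γ 1 0 : ℂ) * τ + γ 1 1 := by
    rw [ModularGroup.denom_apply]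
  have him : (γ • z).im = τ.im / Complex.normSq ((γ 1 0 : ℂ) * τ + γ 1 1) := by
    rw [ModularGroup.im_smul_eq_div_normSq, hden]
    rfl
  refine ⟨γ 1 0, γ 1 1, ?_, ?_, ?_⟩
  · have := γ.det_coe
    rw [Matrix.det_fin_two] at this
    exact ⟨-γ 0 1, γ 0 0, by linarith⟩
  · rw [← him]
    exact ModularGroup.three_le_four_mul_im_sq_of_mem_fd hγ
  · have h1 := norm_eta_inv_eq γ z
    have h2 := norm_eta_inv_le_of_large (τ := ((γ • z : ℍ) : ℂ)) (γ • z).im_pos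
      (ModularGroup.three_le_four_mul_im_sq_of_mem_fd hγ)
    rw [hden] at h1
    change ‖(ModularForm.eta τ)⁻¹‖ = _ at h1
    rw [h1, ← him, mul_comm 1.005, mul_assoc]
    gcongr
    exact h2

lemma normSq_intCast_mul_add (c d : ℤ) (τ : ℂ) :
    Complex.normSq (c * τ + d) = (c * τ.re + d) ^ 2 + (c * τ.im) ^ 2 := by
  simp [Complex.normSq_apply]
  ring

lemma normSq_le_of_three_le {y N : ℝ} (hy : 0 < y) (hN : 0 ≤ N) (h : 3 ≤ 4 * (y / N) ^ 2) :
    N ≤ 1.155 * y := by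
  have hN0 : 0 < N := hN.lt_of_ne (by rintro rfl; norm_num at h)
  rw [div_pow, mul_div_assoc', le_div_iff₀ (by positivity)] at h
  refine (pow_le_pow_iff_left₀ hN (by positivity) two_ne_zero).mp ?_
  nlinarith

/-- The size of the contribution to `1 / η` of the arcs with denominator at least three. -/
noncomputable def minorArcBound (y : ℝ) : ℝ := 1.09 * √√y * Real.exp (π / (108 * y))

lemma norm_eta_inv_le_minor {τ : ℂ} (hτ : 0 < τ.im) {c d : ℤ} (hc : 3 ≤ |c|)
    (h3 : 3 ≤ 4 * (τ.im / Complex.normSq (c * τ + d)) ^ 2)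
    (h : ‖(ModularForm.eta τ)⁻¹‖ ≤ 1.005 * √‖(c * τ + d : ℂ)‖ *
        Real.exp (π / 12 * (τ.im / Complex.normSq (c * τ + d)))) :
    ‖(ModularForm.eta τ)⁻¹‖ ≤ minorArcBound τ.im := by
  refine h.trans ?_
  have hN := normSq_le_of_three_le hτ (Complex.normSq_nonneg _) h3
  have hlow : 9 * τ.im ^ 2 ≤ Complex.normSq (c * τ + d) := by
    rw [normSq_intCast_mul_add]
    have : (3 : ℝ) ≤ |(c : ℝ)| := by exact_mod_cast hc
    have h2 : (9 : ℝ) ≤ (c : ℝ) ^ 2 := by rw [← sq_abs]; nlinarith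
    nlinarith [sq_nonneg ((c : ℝ) * τ.re + d), sq_nonneg τ.im]
  have e1 : √‖(c * τ + d : ℂ)‖ ≤ 1.08 * √√τ.im := by
    have : ‖(c * τ + d : ℂ)‖ ≤ 1.08 * √τ.im := by
      refine (pow_le_pow_iff_left₀ (norm_nonneg _) (by positivity) two_ne_zero).mp ?_
      rw [← Complex.normSq_eq_norm_sq, mul_pow, Real.sq_sqrt hτ.le]
      norm_num at hN ⊢
      linarith
    calc _ ≤ √(1.08 * √τ.im) := Real.sqrt_le_sqrt this
      _ = √1.08 * √√τ.im := Real.sqrt_mul (by norm_num) _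
      _ ≤ 1.08 * √√τ.im := by
        gcongr
        rw [Real.sqrt_le_left (by norm_num)]
        norm_num
  have e2 : π / 12 * (τ.im / Complex.normSq (c * τ + d)) ≤ π / (108 * τ.im) := by
    calc _ ≤ π / 12 * (τ.im / (9 * τ.im ^ 2)) := by gcongr
      _ = _ := by field_simp; norm_num
  rw [minorArcBound]
  calc _ ≤ 1.005 * (1.08 * √√τ.im) * Real.exp (π / (108 * τ.im)) := by gcongr
    _ = (1.005 * 1.08) * √√τ.im * Real.exp (π / (108 * τ.im)) := by ring
    _ ≤ _ := by gcongr; norm_num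

lemma norm_eta_inv_le_near_half {τ : ℂ} (hτ : 0 < τ.im) (hy : τ.im ≤ 1 / 200)
    (hx0 : 1 / 4 ≤ τ.re) (hx1 : τ.re ≤ 3 / 4) :
    ‖(ModularForm.eta τ)⁻¹‖ ≤ 1.005 * √‖2 * τ - 1‖ *
        Real.exp (π / 12 * (τ.im / Complex.normSq (2 * τ - 1))) + minorArcBound τ.im := by
  have hB : 0 ≤ minorArcBound τ.im := by unfold minorArcBound; positivity
  obtain ⟨c, d, hcop, h3, h⟩ := exists_norm_eta_inv_le hτ
  rcases le_or_gt 3 |c| with hc | hc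
  · have := norm_eta_inv_le_minor hτ hc h3 h
    have : 0 ≤ 1.005 * √‖2 * τ - 1‖ *
        Real.exp (π / 12 * (τ.im / Complex.normSq (2 * τ - 1))) := by positivity
    linarith
  · have hN := normSq_le_of_three_le hτ (Complex.normSq_nonneg _) h3
    rw [normSq_intCast_mul_add] at hN
    have hsq : ((c : ℝ) * τ.re + d) ^ 2 ≤ 0.08 ^ 2 := by
      nlinarith [sq_nonneg ((c : ℝ) * τ.im)]
    obtain ⟨hl, hu⟩ := abs_le_of_sq_le_sq' hsq (by norm_num)
    have hc1 : -3 < c := (abs_lt.mp hc).1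
    have hc2 : c < 3 := (abs_lt.mp hc).2
    have fin (h' : (c : ℂ) * τ + d = 2 * τ - 1 ∨ (c : ℂ) * τ + d = -(2 * τ - 1)) :
        ‖(ModularForm.eta τ)⁻¹‖ ≤ 1.005 * √‖2 * τ - 1‖ *
        Real.exp (π / 12 * (τ.im / Complex.normSq (2 * τ - 1))) + minorArcBound τ.im := by
      rcases h' with h' | h' <;> rw [h'] at h
      · linarith
      · rw [norm_neg, Complex.normSq_neg] at h
        linarith
    interval_cases c <;> push_cast at hl hu fin h3
    · have a1 : (0 : ℝ) < d := by linarith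
      have a2 : (d : ℝ) < 2 := by linarith
      norm_cast at a1 a2
      obtain rfl : d = 1 := by omega
      exact fin (.inr (by push_cast; ring))
    · have a1 : (0 : ℝ) < d := by linarith
      have a2 : (d : ℝ) < 1 := by linarith
      norm_cast at a1 a2
      omega
    · have a1 : (-1 : ℝ) < d := by linarith
      have a2 : (d : ℝ) < 1 := by linarith
      norm_cast at a1 a2
      obtain rfl : d = 0 := by omega
      exact (not_isCoprime_zero_zero hcop).elim
    · have a1 : (-1 : ℝ) < d := by linarith
      have a2 : (d : ℝ) < 0 := by linarith
      norm_cast at a1 a2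
      omega
    · have a1 : (-2 : ℝ) < d := by linarith
      have a2 : (d : ℝ) < 0 := by linarith
      norm_cast at a1 a2
      obtain rfl : d = -1 := by omega
      exact fin (.inl (by push_cast; ring))

lemma norm_eta_inv_le_near_zero {τ : ℂ} (hτ : 0 < τ.im) (hy : τ.im ≤ 1 / 200)
    (hx0 : -(1 / 4) ≤ τ.re) (hx1 : τ.re ≤ 1 / 4)
    (hv : 4 * (τ.im / Complex.normSq τ) ^ 2 < 3) :
    ‖(ModularForm.eta τ)⁻¹‖ ≤ minorArcBound τ.im := by
  obtain ⟨c, d, hcop, h3, h⟩ := exists_norm_eta_inv_le hτ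
  rcases le_or_gt 3 |c| with hc | hc
  · exact norm_eta_inv_le_minor hτ hc h3 h
  · exfalso
    have hN := normSq_le_of_three_le hτ (Complex.normSq_nonneg _) h3
    rw [normSq_intCast_mul_add] at hN
    have hsq : ((c : ℝ) * τ.re + d) ^ 2 ≤ 0.08 ^ 2 := by
      nlinarith [sq_nonneg ((c : ℝ) * τ.im)]
    obtain ⟨hl, hu⟩ := abs_le_of_sq_le_sq' hsq (by norm_num)
    have hc1 : -3 < c := (abs_lt.mp hc).1
    have hc2 : c < 3 := (abs_lt.mp hc).2
    have hd0 : d = 0 := by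
      have a : (-1 : ℝ) < d ∧ (d : ℝ) < 1 := by
        interval_cases c <;> push_cast at hl hu <;> constructor <;> linarith
      obtain ⟨a1, a2⟩ := a
      norm_cast at a1 a2
      omega
    subst hd0
    rw [isCoprime_zero_right, Int.isUnit_iff] at hcop
    have hns : Complex.normSq (c * τ + (0 : ℤ)) = Complex.normSq τ := by
      rcases hcop with rfl | rfl <;> simp
    rw [hns] at h3
    linarith

lemma eta_inv_eq_sqrt_mul {s : ℂ} (hs : 0 < s.re) :
    (ModularForm.eta (Complex.I * s))⁻¹ =
      s.sqrt * (Complex.exp (π / 12 / s) * partitionProd (Complex.I / s)) := by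
  have hs0 : s ≠ 0 := by rintro rfl; simp at hs
  have him : 0 < (Complex.I * s).im := by simpa using hs
  have h := ModularForm.eta_comp_eq_csqrt_I_inv him
  have hdiv : -1 / (Complex.I * s) = Complex.I / s := by
    field_simp
    simp
  have hsqrt : (Complex.I * s).sqrt = Complex.I.sqrt * s.sqrt := by
    have harg := abs_lt.mp (Complex.abs_arg_lt_pi_div_two_iff.mpr (.inl hs))
    rw [sqrt_eq_exp (mul_ne_zero Complex.I_ne_zero hs0), sqrt_eq_exp Complex.I_ne_zero,
      sqrt_eq_exp hs0, (Complex.log_mul_eq_add_log_iff Complex.I_ne_zero hs0).mpr, ← Complex.exp_add]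
    · ring_nf
    · rw [Complex.arg_I]
      constructor <;> linarith [Real.pi_pos]
  have hI : Complex.I.sqrt ≠ 0 := by
    rw [sqrt_eq_exp Complex.I_ne_zero]; exact Complex.exp_ne_zero _
  have hss : s.sqrt ≠ 0 := by
    rw [sqrt_eq_exp hs0]; exact Complex.exp_ne_zero _
  simp only [Function.comp_apply, Pi.smul_apply, Pi.mul_apply, smul_eq_mul, hdiv, hsqrt] at h
  have h2 : ModularForm.eta (Complex.I / s) = s.sqrt * ModularForm.eta (Complex.I * s) := by
    rw [h]; field_simp
  have h3 := eta_inv_eq (Complex.I / s)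
  rw [h2, mul_inv] at h3
  have h4 : -(π * Complex.I / 12 * (Complex.I / s)) = π / 12 / s := by
    field_simp
    simp
  rw [h4] at h3
  rw [← h3, mul_inv_cancel_left₀ hss]

lemma norm_csqrt {s : ℂ} (hs : s ≠ 0) : ‖s.sqrt‖ = √‖s‖ := by
  rw [sqrt_eq_exp hs, Complex.norm_exp, Complex.div_ofNat_re, Complex.log_re,
    Real.exp_half, Real.exp_log (norm_pos_iff.mpr hs)]

lemma re_div_self_eq (a : ℝ) (s : ℂ) : ((a : ℂ) / s).re = a * (s.re / Complex.normSq s) := by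
  rw [Complex.div_re]
  simp
  ring

lemma norm_eta_inv_sub_le {s : ℂ} (hs : 0 < s.re) (hy : s.re ≤ 1 / 200) (hx : |s.im| ≤ 1 / 4) :
    ‖(ModularForm.eta (Complex.I * s))⁻¹ - s.sqrt * Complex.exp (π / 12 / s)‖ ≤
      minorArcBound s.re + 1 := by
  have hs0 : s ≠ 0 := by rintro rfl; simp at hs
  have hB : 0 ≤ minorArcBound s.re := by unfold minorArcBound; positivity
  have hnorm : ‖s‖ ≤ 0.26 := by
    have := Complex.normSq_apply s
    rw [Complex.normSq_eq_norm_sq] at this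
    have h2 : s.im * s.im ≤ (1 / 4) ^ 2 := by rw [← sq, ← sq_abs]; gcongr
    refine (pow_le_pow_iff_left₀ (norm_nonneg _) (by norm_num) two_ne_zero).mp ?_
    nlinarith
  have hsq : √‖s‖ ≤ 0.51 := by
    rw [Real.sqrt_le_left (by norm_num)]
    norm_num at hnorm ⊢
    linarith
  have hnsq : 0 < Complex.normSq s := Complex.normSq_pos.mpr hs0
  set v := s.re / Complex.normSq s with hv
  have hv0 : 0 < v := by positivity
  have hexp : ‖Complex.exp (π / 12 / s)‖ = Real.exp (π / 12 * v) := by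
    rw [Complex.norm_exp, hv]
    congr 1
    have := re_div_self_eq (π / 12) s
    push_cast at this
    exact this
  have hvim : (Complex.I / s).im = v := by
    rw [Complex.div_im]
    simp [hv]
  rcases le_or_gt 3 (4 * v ^ 2) with h | h
  · rw [eta_inv_eq_sqrt_mul hs]
    have h1 := norm_partitionProd_sub_one_le_of_large (τ := Complex.I / s) (by rwa [hvim])
      (by rwa [hvim])
    rw [hvim] at h1
    rw [show s.sqrt * (Complex.exp (π / 12 / s) * partitionProd (Complex.I / s)) -
        s.sqrt * Complex.exp (π / 12 / s) =
        s.sqrt * (Complex.exp (π / 12 / s) * (partitionProd (Complex.I / s) - 1)) by ring,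
      norm_mul, norm_mul, norm_csqrt hs0, hexp]
    have h2 : Real.exp (π / 12 * v) * ‖partitionProd (Complex.I / s) - 1‖ ≤ 1.01 := by
      calc _ ≤ Real.exp (π / 12 * v) * (1.01 * Real.exp (-(2 * π * v))) := by gcongr
        _ = 1.01 * Real.exp (-(23 / 12 * π * v)) := by
          rw [mul_left_comm, ← Real.exp_add]; ring_nf
        _ ≤ 1.01 * 1 := by
          gcongr
          rw [Real.exp_le_one_iff]
          have : 0 < 23 / 12 * π * v := by positivity
          linarith
        _ = 1.01 := by norm_num
    calc _ ≤ 0.51 * 1.01 := by gcongr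
      _ ≤ minorArcBound s.re + 1 := by norm_num; linarith
  · have h1 := norm_eta_inv_le_near_zero (τ := Complex.I * s) (by simpa using hs)
      (by simpa using hy) (by simpa using (abs_le.mp hx).2)
      (by have := (abs_le.mp hx).1; simp at this ⊢; linarith) (by simpa [← hv] using h)
    have h2 : ‖s.sqrt * Complex.exp (π / 12 / s)‖ ≤ 1 := by
      rw [norm_mul, norm_csqrt hs0, hexp]
      have hv1 : v ≤ 0.87 := by nlinarith
      have : π / 12 * v ≤ 0.4 := by nlinarith [Real.pi_lt_d2, Real.pi_pos]
      have h3 : Real.exp (π / 12 * v) ≤ 1.8 := by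
        refine (Real.exp_le_exp.mpr this).trans ?_
        have := Real.exp_bound_div_one_sub_of_interval (x := 0.4) (by norm_num) (by norm_num)
        norm_num at this ⊢
        linarith
      calc √‖s‖ * Real.exp (π / 12 * v) ≤ 0.51 * 1.8 := by gcongr
        _ ≤ 1 := by norm_num
    simp only [Complex.mul_im, Complex.I_re, Complex.I_im, zero_mul, one_mul, zero_add] at h1
    exact (norm_sub_le _ _).trans (add_le_add h1 h2)

/-- The integral of `exp (w ^ 2)` along the vertical ray going up from `z`. -/
noncomputable def gaussianRay (z : ℂ) : ℂ :=
  ∫ r in Set.Ioi (0 : ℝ), Complex.exp ((z + Complex.I * r) ^ 2)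

lemma add_I_mul_sq (z : ℂ) (r : ℝ) :
    (z + Complex.I * r) ^ 2 = -1 * (r : ℂ) ^ 2 + (2 * Complex.I * z) * r + z ^ 2 := by
  linear_combination (r : ℂ) ^ 2 * Complex.I_sq

lemma re_add_I_mul_sq (z : ℂ) (r : ℝ) :
    ((z + Complex.I * r) ^ 2).re = z.re ^ 2 - (z.im + r) ^ 2 := by
  simp [sq]

lemma integrable_cexp_add_I_mul_sq (z : ℂ) :
    MeasureTheory.Integrable fun r : ℝ ↦ Complex.exp ((z + Complex.I * r) ^ 2) := by
  simp_rw [add_I_mul_sq]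
  exact integrable_cexp_quadratic (by norm_num) _ _

lemma gaussianRay_add_neg (z : ℂ) : gaussianRay z + gaussianRay (-z) = √π := by
  have h1 : gaussianRay (-z) =
      ∫ r in Set.Iic (0 : ℝ), Complex.exp ((z + Complex.I * r) ^ 2) := by
    rw [gaussianRay]
    have := integral_comp_neg_Ioi 0 fun r : ℝ ↦ Complex.exp ((z + Complex.I * r) ^ 2)
    rw [neg_zero] at this
    rw [← this]
    congr 1
    ext r
    congr 1
    push_cast
    ring
  rw [h1, gaussianRay, add_comm, intervalIntegral.integral_Iic_add_Ioi
    (integrable_cexp_add_I_mul_sq z).integrableOn (integrable_cexp_add_I_mul_sq z).integrableOn]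
  simp_rw [add_I_mul_sq]
  rw [integral_cexp_quadratic (by norm_num)]
  have : z ^ 2 - (2 * Complex.I * z) ^ 2 / (4 * -1) = 0 := by
    linear_combination z ^ 2 * Complex.I_sq
  rw [this, Complex.exp_zero, mul_one, neg_neg, div_one, Real.sqrt_eq_rpow,
    Complex.ofReal_cpow Real.pi_pos.le]
  norm_num

lemma norm_gaussianRay_le {z : ℂ} (hz : 0 ≤ z.im) :
    ‖gaussianRay z‖ ≤ √π / 2 * Real.exp ((z ^ 2).re) := by
  have h : √π / 2 * Real.exp ((z ^ 2).re) =
      ∫ r in Set.Ioi (0 : ℝ), Real.exp ((z ^ 2).re) * Real.exp (-1 * r ^ 2) := by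
    rw [MeasureTheory.integral_const_mul, integral_gaussian_Ioi, div_one, mul_comm]
  rw [h, gaussianRay]
  refine MeasureTheory.norm_integral_le_of_norm_le ?_ ?_
  · exact ((integrable_exp_neg_mul_sq one_pos).const_mul _).integrableOn
  · refine (MeasureTheory.ae_restrict_iff' measurableSet_Ioi).mpr (.of_forall fun r hr ↦ ?_)
    rw [Complex.norm_exp, re_add_I_mul_sq, ← Real.exp_add, Real.exp_le_exp]
    have : (z ^ 2).re = z.re ^ 2 - z.im ^ 2 := by simp [sq]
    rw [this]
    nlinarith [mul_nonneg hz (le_of_lt (Set.mem_Ioi.mp hr))]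

lemma hasDerivAt_gaussianRay (z : ℂ) :
    HasDerivAt gaussianRay (Complex.I * Complex.exp (z ^ 2)) z := by
  set F' : ℂ → ℝ → ℂ := fun z r ↦
    Complex.exp ((z + Complex.I * r) ^ 2) * (2 * (z + Complex.I * r))
  set R := ‖z‖ + 1
  have hd (r : ℝ) (w : ℂ) : HasDerivAt (fun w : ℂ ↦ Complex.exp ((w + Complex.I * r) ^ 2))
      (F' w r) w := by
    have := (((hasDerivAt_id w).add_const (Complex.I * r)).pow 2).cexp
    simpa [F'] using this
  have hbi : MeasureTheory.Integrable (fun r : ℝ ↦ ‖2 * Complex.exp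
      (-1 * (r : ℂ) ^ 2 + (2 * R + 1 : ℝ) * r + (R ^ 2 + R : ℝ))‖) 
      (MeasureTheory.volume.restrict (Set.Ioi 0)) :=
    (((integrable_cexp_quadratic (b := 1) (by norm_num) _ _).const_mul 2).norm).integrableOn
  have key := hasDerivAt_integral_of_dominated_loc_of_deriv_le
    (μ := MeasureTheory.volume.restrict (Set.Ioi (0 : ℝ)))
    (F := fun (w : ℂ) (r : ℝ) ↦ Complex.exp ((w + Complex.I * r) ^ 2)) (F' := F') (x₀ := z)
    (s := Metric.ball z 1) (Metric.ball_mem_nhds z one_pos) 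
    (.of_forall fun w ↦ (integrable_cexp_add_I_mul_sq w).aestronglyMeasurable.restrict)
    (integrable_cexp_add_I_mul_sq z).integrableOn
    (Continuous.aestronglyMeasurable (by fun_prop)) ?_ hbi (.of_forall fun r w _ ↦ hd r w)
  · have hlim : Tendsto (fun r : ℝ ↦ -Complex.I * Complex.exp ((z + Complex.I * r) ^ 2))
        atTop (𝓝 0) := by
      rw [← mul_zero (-Complex.I)]
      refine Tendsto.const_mul _ ?_
      rw [tendsto_zero_iff_norm_tendsto_zero]
      simp_rw [Complex.norm_exp, re_add_I_mul_sq]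
      refine Real.tendsto_exp_atBot.comp ?_
      refine tendsto_atBot_add_const_left _ _ (tendsto_neg_atTop_atBot.comp ?_)
      exact (tendsto_pow_atTop two_ne_zero).comp (tendsto_atTop_add_const_left _ _ tendsto_id)
    have hr (r : ℝ) : HasDerivAt (fun r : ℝ ↦
        -Complex.I * Complex.exp ((z + Complex.I * r) ^ 2)) (F' z r) r := by
      have h0 : HasDerivAt (fun r : ℝ ↦ z + Complex.I * (r : ℂ)) (Complex.I * 1) r :=
        ((Complex.ofRealCLM.hasDerivAt (x := r)).const_mul Complex.I).const_add z
      have := ((h0.pow 2).cexp).const_mul (-Complex.I)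
      refine this.congr_deriv ?_
      simp only [F', Pi.pow_apply]
      push_cast
      linear_combination (-(Complex.exp ((z + Complex.I * r) ^ 2) * (2 * (z + Complex.I * r)))) *
        Complex.I_sq
    have := MeasureTheory.integral_Ioi_of_hasDerivAt_of_tendsto
      (hr 0).continuousAt.continuousWithinAt (fun r _ ↦ hr r) key.1 hlim
    have h2 := key.2
    rw [this] at h2
    simp only [Complex.ofReal_zero, mul_zero, add_zero, zero_sub, neg_mul, neg_neg] at h2
    exact h2
  · refine (MeasureTheory.ae_restrict_iff' measurableSet_Ioi).mpr (.of_forall fun r hr w hw ↦ ?_)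
    have hr : 0 < r := hr
    have hw : ‖w‖ ≤ R := by
      have := norm_sub_norm_le w z
      rw [Metric.mem_ball, dist_eq_norm] at hw
      simp only [R]
      linarith
    have hre := (abs_le.mp (Complex.abs_re_le_norm w))
    have him := (abs_le.mp (Complex.abs_im_le_norm w))
    have h1 : ‖w + Complex.I * r‖ ≤ Real.exp (R + r) := by
      calc _ ≤ ‖w‖ + ‖Complex.I * r‖ := norm_add_le _ _
        _ ≤ R + r := by simp [abs_of_pos hr, hw]
        _ ≤ _ := by linarith [Real.add_one_le_exp (R + r)]
    have h2 : ((w + Complex.I * r) ^ 2).re ≤ R ^ 2 + 2 * R * r - r ^ 2 := by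
      rw [re_add_I_mul_sq]
      have : w.re ^ 2 ≤ R ^ 2 := by
        rw [← sq_abs]
        have := Complex.abs_re_le_norm w
        gcongr
        linarith
      nlinarith [sq_nonneg w.im]
    have h3 : ‖2 * Complex.exp (-1 * (r : ℂ) ^ 2 + (2 * R + 1 : ℝ) * r + (R ^ 2 + R : ℝ))‖ =
        2 * Real.exp (-1 * r ^ 2 + (2 * R + 1) * r + (R ^ 2 + R)) := by
      rw [norm_mul, Complex.norm_exp]
      norm_cast
    rw [h3]
    simp only [F', norm_mul, Complex.norm_exp, Complex.norm_ofNat]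
    calc _ ≤ Real.exp (R ^ 2 + 2 * R * r - r ^ 2) * (2 * Real.exp (R + r)) := by gcongr
      _ = _ := by rw [mul_left_comm, ← Real.exp_add]; ring_nf

/-- An antiderivative of `w ↦ 2 * w ^ 2 * exp (A ^ 2 / w ^ 2 + M ^ 2 * w ^ 2)`. -/
noncomputable def saddlePrimitive (A M : ℝ) (w : ℂ) : ℂ :=
  1 / M ^ 2 * (w * Complex.exp (A ^ 2 / w ^ 2 + M ^ 2 * w ^ 2) +
    Complex.I * (1 / (2 * M) - A) * (Complex.exp (2 * A * M) * gaussianRay (M * w - A / w)) +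
    Complex.I * (1 / (2 * M) + A) * (Complex.exp (-(2 * A * M)) * gaussianRay (M * w + A / w)))

lemma hasDerivAt_saddlePrimitive (A : ℝ) {M : ℝ} (hM : M ≠ 0) {w : ℂ} (hw : w ≠ 0) :
    HasDerivAt (saddlePrimitive A M)
      (2 * w ^ 2 * Complex.exp (A ^ 2 / w ^ 2 + M ^ 2 * w ^ 2)) w := by
  have hMC : (M : ℂ) ≠ 0 := by exact_mod_cast hM
  set e := Complex.exp (A ^ 2 / w ^ 2 + M ^ 2 * w ^ 2) with he
  have hi : HasDerivAt (fun w : ℂ ↦ (A : ℂ) / w) (-(A / w ^ 2)) w := by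
    have := (hasDerivAt_inv hw).const_mul (A : ℂ)
    simp only [← div_eq_mul_inv] at this
    refine this.congr_deriv ?_
    ring
  have hl : HasDerivAt (fun w : ℂ ↦ (M : ℂ) * w) M w := by
    simpa using (hasDerivAt_id w).const_mul (M : ℂ)
  have h1 : HasDerivAt (fun w : ℂ ↦ Complex.exp (2 * A * M) * gaussianRay (M * w - A / w))
      (Complex.I * e * (M + A / w ^ 2)) w := by
    have := ((hasDerivAt_gaussianRay _).comp w (hl.sub hi)).const_mul (Complex.exp (2 * A * M))
    refine this.congr_deriv ?_
    have h : e = Complex.exp (2 * A * M) * Complex.exp ((M * w - A / w) ^ 2) := by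
      rw [he, ← Complex.exp_add]
      congr 1
      field_simp
      ring
    rw [h]
    simp only [Pi.sub_apply]
    ring
  have h2 : HasDerivAt (fun w : ℂ ↦ Complex.exp (-(2 * A * M)) * gaussianRay (M * w + A / w))
      (Complex.I * e * (M - A / w ^ 2)) w := by
    have := ((hasDerivAt_gaussianRay _).comp w (hl.add hi)).const_mul
      (Complex.exp (-(2 * A * M)))
    refine this.congr_deriv ?_
    have h : e = Complex.exp (-(2 * A * M)) * Complex.exp ((M * w + A / w) ^ 2) := by
      rw [he, ← Complex.exp_add]
      congr 1
      field_simp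
      ring
    rw [h]
    simp only [Pi.add_apply]
    ring
  have h3 : HasDerivAt (fun w : ℂ ↦ w * Complex.exp (A ^ 2 / w ^ 2 + M ^ 2 * w ^ 2))
      (e * (1 + 2 * M ^ 2 * w ^ 2 - 2 * A ^ 2 / w ^ 2)) w := by
    have := (hasDerivAt_id w).mul ((hi.pow 2).add (hl.pow 2)).cexp
    simp only [Pi.add_apply, Pi.pow_apply, id, div_pow, mul_pow] at this
    refine HasDerivAt.congr_deriv this ?_
    rw [← he]
    push_cast
    field_simp
    ring
  refine (((h3.add (h1.const_mul (Complex.I * (1 / (2 * M) - A)))).add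
    (h2.const_mul (Complex.I * (1 / (2 * M) + A)))).const_mul
      (1 / (M : ℂ) ^ 2)).congr_deriv ?_
  field_simp
  ring_nf
  rw [Complex.I_sq]
  ring

/-- The value of `saddlePrimitive A M w + saddlePrimitive A M (-w)`. -/
lemma saddlePrimitive_add_neg (A M : ℝ) (w : ℂ) :
    saddlePrimitive A M w + saddlePrimitive A M (-w) =
      Complex.I * √π / M ^ 2 * ((1 / (2 * M) - A) * Complex.exp (2 * A * M) +
        (1 / (2 * M) + A) * Complex.exp (-(2 * A * M))) := by
  have h1 := gaussianRay_add_neg (M * w - A / w)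
  have h2 := gaussianRay_add_neg (M * w + A / w)
  have e1 : (M : ℂ) * -w - A / -w = -(M * w - A / w) := by rw [div_neg]; ring
  have e2 : (M : ℂ) * -w + A / -w = -(M * w + A / w) := by rw [div_neg]; ring
  simp only [saddlePrimitive, e1, e2, neg_sq]
  linear_combination 1 / (M : ℂ) ^ 2 * (Complex.I * (1 / (2 * M) - A) * Complex.exp (2 * A * M)) *
    h1 + 1 / (M : ℂ) ^ 2 * (Complex.I * (1 / (2 * M) + A) * Complex.exp (-(2 * A * M))) * h2

lemma norm_saddlePrimitive_le {A M : ℝ} (hA : 0 ≤ A) (hM : 0 < M) {w : ℂ} (hw : 0 < w.im)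
    (h : A ≤ M * Complex.normSq w) :
    ‖saddlePrimitive A M w‖ ≤ 1 / M ^ 2 * ((‖w‖ + √π * (1 / (2 * M) + A)) *
      ‖Complex.exp (A ^ 2 / w ^ 2 + M ^ 2 * w ^ 2)‖) := by
  have hw0 : w ≠ 0 := by rintro rfl; simp at hw
  set e := ‖Complex.exp (A ^ 2 / w ^ 2 + M ^ 2 * w ^ 2)‖ with he
  have hdiv : ((A : ℂ) / w).im = -(A * w.im / Complex.normSq w) := by
    rw [Complex.div_im]
    simp
  have hns : 0 < Complex.normSq w := Complex.normSq_pos.mpr hw0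
  have b0 : 0 ≤ A * w.im / Complex.normSq w := by positivity
  have b1 : A * w.im / Complex.normSq w ≤ M * w.im := by
    rw [div_le_iff₀ hns]
    nlinarith
  have e1 : ‖Complex.exp (2 * A * M) * gaussianRay (M * w - A / w)‖ ≤ √π / 2 * e := by
    have := norm_gaussianRay_le (z := M * w - A / w) (by
      rw [Complex.sub_im, hdiv]
      simp only [Complex.im_ofReal_mul]
      nlinarith [mul_pos hM hw])
    rw [norm_mul]
    calc _ ≤ ‖Complex.exp (2 * A * M)‖ * (√π / 2 * Real.exp (((M * w - A / w) ^ 2).re)) := by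
          gcongr
      _ = _ := by
        rw [← Complex.norm_exp, mul_left_comm, ← norm_mul, ← Complex.exp_add, he]
        congr 3
        field_simp
        ring
  have e2 : ‖Complex.exp (-(2 * A * M)) * gaussianRay (M * w + A / w)‖ ≤ √π / 2 * e := by
    have := norm_gaussianRay_le (z := M * w + A / w) (by
      rw [Complex.add_im, hdiv]
      simp only [Complex.im_ofReal_mul]
      linarith)
    rw [norm_mul]
    calc _ ≤ ‖Complex.exp (-(2 * A * M))‖ * (√π / 2 * Real.exp (((M * w + A / w) ^ 2).re)) := by
          gcongr
      _ = _ := by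
        rw [← Complex.norm_exp, mul_left_comm, ← norm_mul, ← Complex.exp_add, he]
        congr 3
        field_simp
        ring
  have e3 : ‖(1 / (2 * M) - A : ℂ)‖ ≤ 1 / (2 * M) + A := by
    refine (norm_sub_le _ _).trans (le_of_eq ?_)
    simp [abs_of_pos hM, abs_of_nonneg hA]
  have e4 : ‖(1 / (2 * M) + A : ℂ)‖ ≤ 1 / (2 * M) + A := by
    refine (norm_add_le _ _).trans (le_of_eq ?_)
    simp [abs_of_pos hM, abs_of_nonneg hA]
  rw [saddlePrimitive, norm_mul]
  have e5 : ‖(1 / M ^ 2 : ℂ)‖ = 1 / M ^ 2 := by simp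
  rw [e5]
  gcongr
  refine norm_add₃_le.trans ?_
  rw [mul_assoc Complex.I, mul_assoc Complex.I]
  rw [norm_mul w, norm_mul Complex.I, norm_mul Complex.I, Complex.norm_I, one_mul, one_mul, norm_mul,
    norm_mul _ (Complex.exp (-(2 * A * M)) * _), ← he]
  calc _ ≤ ‖w‖ * e + (1 / (2 * M) + A) * (√π / 2 * e) + (1 / (2 * M) + A) * (√π / 2 * e) := by
        gcongr
    _ = _ := by ring

lemma csqrt_sq {s : ℂ} (hs : s ≠ 0) : s.sqrt ^ 2 = s := by
  rw [sqrt_eq_exp hs, ← Complex.exp_nat_mul, Nat.cast_ofNat, mul_div_cancel₀ _ two_ne_zero,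
    Complex.exp_log hs]

lemma csqrt_re_pos {s : ℂ} (hs : 0 < s.re) : 0 < s.sqrt.re := by
  have hs0 : s ≠ 0 := by rintro rfl; simp at hs
  have harg := abs_lt.mp (Complex.abs_arg_lt_pi_div_two_iff.mpr (.inl hs))
  rw [sqrt_eq_exp hs0, Complex.exp_re, Complex.div_ofNat_im, Complex.log_im]
  have := Real.cos_pos_of_mem_Ioo (x := s.arg / 2) ⟨by linarith [Real.pi_pos], by linarith [Real.pi_pos]⟩
  positivity

lemma two_mul_csqrt_re_mul_im {s : ℂ} (hs : s ≠ 0) : 2 * s.sqrt.re * s.sqrt.im = s.im := by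
  have := congrArg Complex.im (csqrt_sq hs)
  rw [sq, Complex.mul_im] at this
  linarith

lemma hasDerivAt_csqrt {s : ℂ} (hs : 0 < s.re) : HasDerivAt Complex.sqrt (1 / (2 * s.sqrt)) s := by
  have hs0 : s ≠ 0 := by rintro rfl; simp at hs
  refine (Complex.hasDerivAt_sqrt (.inl hs)).congr_deriv ?_
  rw [neg_div, Complex.cpow_neg, Complex.sqrt]
  simp [mul_comm, div_eq_mul_inv]

lemma norm_saddlePrimitive_le_of_sq {A M y : ℝ} (hA : 0 ≤ A) (hM : 0 < M) (hy : 0 < y)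
    (hy' : y ≤ 1 / 200) (hAM : 4 * A ≤ M) {w : ℂ} (hw : 0 < w.im) {t : ℝ} (ht : |t| = 1 / 4)
    (h : w ^ 2 = y - t * Complex.I) :
    ‖saddlePrimitive A M w‖ ≤ 1 / M ^ 2 * ((0.52 + √π * (1 / (2 * M) + A)) *
      Real.exp (16 * A ^ 2 * y + M ^ 2 * y)) := by
  have ht2 : t ^ 2 = 1 / 16 := by rw [← sq_abs, ht]; norm_num
  have hn4 : Complex.normSq (y - t * Complex.I) = y ^ 2 + 1 / 16 := by
    rw [← ht2, Complex.normSq_apply]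
    simp
    ring
  have hn : Complex.normSq w ^ 2 = y ^ 2 + 1 / 16 := by
    rw [← map_pow, h, hn4]
  have hn1 : 1 / 4 ≤ Complex.normSq w := by
    refine (pow_le_pow_iff_left₀ (by norm_num) (Complex.normSq_nonneg _) two_ne_zero).mp ?_
    rw [hn]
    nlinarith
  refine (norm_saddlePrimitive_le hA hM hw (by nlinarith)).trans ?_
  have e1 : ‖w‖ ≤ 0.52 := by
    refine (pow_le_pow_iff_left₀ (norm_nonneg _) (by norm_num) two_ne_zero).mp ?_
    rw [← Complex.normSq_eq_norm_sq]
    refine (pow_le_pow_iff_left₀ (Complex.normSq_nonneg _) (by norm_num) two_ne_zero).mp ?_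
    rw [hn]
    nlinarith
  have e2 : ‖Complex.exp (A ^ 2 / w ^ 2 + M ^ 2 * w ^ 2)‖ ≤
      Real.exp (16 * A ^ 2 * y + M ^ 2 * y) := by
    rw [Complex.norm_exp, Real.exp_le_exp, h, Complex.add_re]
    have h1 := re_div_self_eq (A ^ 2) (y - t * Complex.I)
    have h2 : (((M ^ 2 : ℝ) : ℂ) * (y - t * Complex.I)).re = M ^ 2 * y := by
      rw [Complex.re_ofReal_mul]; simp
    push_cast at h1 h2
    rw [h1, h2, hn4]
    have : ((y : ℂ) - t * Complex.I).re = y := by simp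
    rw [this]
    have : y / (y ^ 2 + 1 / 16) ≤ 16 * y := by
      rw [div_le_iff₀ (by positivity)]
      nlinarith [pow_pos hy 3]
    nlinarith [mul_le_mul_of_nonneg_left this (sq_nonneg A)]
  gcongr

lemma norm_integral_saddle_sub_le {A M y : ℝ} (hA : 0 ≤ A) (hM : 0 < M) (hy : 0 < y)
    (hy' : y ≤ 1 / 200) (hAM : 4 * A ≤ M) :
    ‖(∫ x in (-(1 / 4) : ℝ)..(1 / 4), (y - x * Complex.I : ℂ).sqrt *
        Complex.exp (A ^ 2 / (y - x * Complex.I) + M ^ 2 * (y - x * Complex.I))) -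
      (√π / M ^ 2 * ((A - 1 / (2 * M)) * Real.exp (2 * A * M) -
        (A + 1 / (2 * M)) * Real.exp (-(2 * A * M))) : ℝ)‖ ≤
      2 * (1 / M ^ 2 * ((0.52 + √π * (1 / (2 * M) + A)) *
      Real.exp (16 * A ^ 2 * y + M ^ 2 * y))) := by
  have hre (x : ℝ) : 0 < (y - x * Complex.I : ℂ).re := by simpa
  have h0 (x : ℝ) : (y - x * Complex.I : ℂ) ≠ 0 := by
    intro h
    have := hre x
    simp [h] at this
  have hs0 (x : ℝ) : (y - x * Complex.I : ℂ).sqrt ≠ 0 := by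
    intro h
    have := csqrt_re_pos (hre x)
    simp [h] at this
  have hd (x : ℝ) : HasDerivAt (fun x : ℝ ↦
      Complex.I * saddlePrimitive A M (y - x * Complex.I : ℂ).sqrt)
      ((y - x * Complex.I : ℂ).sqrt *
        Complex.exp (A ^ 2 / (y - x * Complex.I) + M ^ 2 * (y - x * Complex.I))) x := by
    have hl : HasDerivAt (fun x : ℝ ↦ (y - x * Complex.I : ℂ)) (-(1 * Complex.I)) x :=
      ((Complex.ofRealCLM.hasDerivAt (x := x)).mul_const Complex.I).const_sub (y : ℂ)
    have h1 := (hasDerivAt_csqrt (hre x)).comp x hl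
    have h2 := ((hasDerivAt_saddlePrimitive A hM.ne' (hs0 x)).comp x h1).const_mul Complex.I
    refine h2.congr_deriv ?_
    have hE : Complex.exp (A ^ 2 / (y - x * Complex.I : ℂ).sqrt ^ 2 +
        M ^ 2 * (y - x * Complex.I : ℂ).sqrt ^ 2) =
        Complex.exp (A ^ 2 / (y - x * Complex.I) + M ^ 2 * (y - x * Complex.I)) := by
      rw [csqrt_sq (h0 x)]
    rw [hE]
    have := hs0 x
    generalize (y - x * Complex.I : ℂ).sqrt = r at this ⊢
    field_simp
    rw [Complex.I_sq]
    ring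
  rw [intervalIntegral.integral_eq_sub_of_hasDerivAt (fun x _ ↦ hd x)]
  · set w₁ := (y - ((1 / 4 : ℝ) : ℂ) * Complex.I : ℂ).sqrt with hw₁
    set w₂ := (y - ((-(1 / 4) : ℝ) : ℂ) * Complex.I : ℂ).sqrt with hw₂
    have i1 : 0 < (-w₁).im := by
      have h1 := csqrt_re_pos (hre (1 / 4))
      have h2 := two_mul_csqrt_re_mul_im (h0 (1 / 4))
      rw [← hw₁] at h1 h2
      have h3 : (y - ((1 / 4 : ℝ) : ℂ) * Complex.I : ℂ).im = -(1 / 4) := by simp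
      rw [h3] at h2
      rw [Complex.neg_im]
      by_contra! hc
      nlinarith
    have i2 : 0 < w₂.im := by
      have h1 := csqrt_re_pos (hre (-(1 / 4)))
      have h2 := two_mul_csqrt_re_mul_im (h0 (-(1 / 4)))
      rw [← hw₂] at h1 h2
      have h3 : (y - ((-(1 / 4) : ℝ) : ℂ) * Complex.I : ℂ).im = 1 / 4 := by simp
      rw [h3] at h2
      by_contra! hc
      nlinarith
    have b1 := norm_saddlePrimitive_le_of_sq hA hM hy hy' hAM i1 (t := 1 / 4)
      (by norm_num) (by rw [neg_sq, csqrt_sq (h0 _)])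
    have b2 := norm_saddlePrimitive_le_of_sq hA hM hy hy' hAM i2 (t := -(1 / 4))
      (by rw [abs_neg]; norm_num) (csqrt_sq (h0 _))
    have hadd := saddlePrimitive_add_neg A M w₁
    have heq : Complex.I * saddlePrimitive A M w₁ - Complex.I * saddlePrimitive A M w₂ -
      (√π / M ^ 2 * ((A - 1 / (2 * M)) * Real.exp (2 * A * M) -
        (A + 1 / (2 * M)) * Real.exp (-(2 * A * M))) : ℝ) =
        Complex.I * (-saddlePrimitive A M (-w₁) - saddlePrimitive A M w₂) := by
      push_cast
      linear_combination Complex.I * hadd + (√π / M ^ 2 * ((1 / (2 * M) - A) *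
        Complex.exp (2 * A * M) + (1 / (2 * M) + A) * Complex.exp (-(2 * A * M)))) * Complex.I_sq
    rw [heq, norm_mul, Complex.norm_I, one_mul]
    refine (norm_sub_le _ _).trans ?_
    rw [norm_neg]
    linarith
  · refine Continuous.intervalIntegrable ?_ _ _
    have h1 : Continuous fun x : ℝ ↦ (y - x * Complex.I : ℂ).sqrt := by
      refine continuous_iff_continuousAt.mpr fun x ↦ ?_
      have hl : HasDerivAt (fun x : ℝ ↦ (y - x * Complex.I : ℂ)) (-(1 * Complex.I)) x :=
        ((Complex.ofRealCLM.hasDerivAt (x := x)).mul_const Complex.I).const_sub (y : ℂ)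
      exact ((hasDerivAt_csqrt (hre x)).comp x hl).continuousAt
    refine h1.mul (Complex.continuous_exp.comp ?_)
    refine .add (.div (by fun_prop) (by fun_prop) h0) (by fun_prop)

lemma integral_cexp_two_pi_int (m : ℤ) (a y : ℝ) :
    ∫ x in a..(a + 1), Complex.exp (2 * π * Complex.I * m * (Complex.I * (y - x * Complex.I))) =
      if m = 0 then 1 else 0 := by
  have h (x : ℝ) : Complex.exp (2 * π * Complex.I * m * (Complex.I * (y - x * Complex.I))) =
      Complex.exp (-(2 * π * m * y)) * Complex.exp ((2 * π * Complex.I * m) * x) := by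
    rw [← Complex.exp_add]
    congr 1
    linear_combination (2 * π * m * y - 2 * π * Complex.I * m * x) * Complex.I_sq
  simp_rw [h]
  split_ifs with hm
  · simp [hm]
  · have hm' : (2 * π * Complex.I * m : ℂ) ≠ 0 := by
      have : (m : ℂ) ≠ 0 := by exact_mod_cast hm
      have := Complex.I_ne_zero
      have : (π : ℂ) ≠ 0 := by exact_mod_cast Real.pi_ne_zero
      simp_all
    rw [intervalIntegral.integral_const_mul, integral_exp_mul_complex hm']
    have : Complex.exp (2 * π * Complex.I * m * (a + 1 : ℝ)) =
        Complex.exp (2 * π * Complex.I * m * a) := by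
      push_cast
      rw [mul_add, Complex.exp_add, mul_one]
      have := Complex.exp_int_mul_two_pi_mul_I m
      rw [show 2 * π * Complex.I * m = m * (2 * π * Complex.I) by ring, this, mul_one]
    rw [this]
    simp

/-- The integrand in Cauchy's formula for the number of partitions of `n`. -/
noncomputable def circleIntegrand (n : ℕ) (s : ℂ) : ℂ :=
  (ModularForm.eta (Complex.I * s))⁻¹ * Complex.exp (2 * π * (n - 1 / 24) * s)

lemma hasSum_circleIntegrand (n : ℕ) {s : ℂ} (hs : 0 < s.re) :
    HasSum (fun k : ℕ ↦ (Fintype.card (Nat.Partition k) : ℂ) *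
      Complex.exp (2 * π * Complex.I * ((k - n : ℤ) : ℂ) * (Complex.I * s)))
      (circleIntegrand n s) := by
  have h := (hasSum_partitionProd (τ := Complex.I * s) (by simpa using hs)).mul_right
    (Complex.exp (-(2 * π * Complex.I * n * (Complex.I * s))))
  have e : circleIntegrand n s = partitionProd (Complex.I * s) *
      Complex.exp (-(2 * π * Complex.I * n * (Complex.I * s))) := by
    unfold circleIntegrand
    rw [eta_inv_eq, mul_comm (Complex.exp (-_)), mul_assoc, ← Complex.exp_add]
    congr 2
    linear_combination (-(π / 12) + 2 * π * n : ℂ) * s * Complex.I_sq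
  rw [e]
  refine h.congr_fun fun k ↦ ?_
  rw [mul_assoc _ (Complex.exp _ ^ k), ← Complex.exp_nat_mul, ← Complex.exp_add]
  congr 2
  push_cast
  ring

lemma norm_circle_term (n k : ℕ) (s : ℂ) :
    ‖(Fintype.card (Nat.Partition k) : ℂ) *
      Complex.exp (2 * π * Complex.I * ((k - n : ℤ) : ℂ) * (Complex.I * s))‖ =
    (Fintype.card (Nat.Partition k) : ℝ) * Real.exp (-(2 * π * s.re)) ^ k *
      Real.exp (2 * π * s.re * n) := by
  have : 2 * π * Complex.I * ((k - n : ℤ) : ℂ) * (Complex.I * s) =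
      ((-(2 * π * (k - n)) : ℝ) : ℂ) * s := by
    push_cast
    linear_combination (2 * π * (k - n) * s : ℂ) * Complex.I_sq
  rw [norm_mul, Complex.norm_natCast, Complex.norm_exp, this, Complex.re_ofReal_mul,
    mul_assoc _ (Real.exp _ ^ k),
    ← Real.exp_nat_mul, ← Real.exp_add]
  ring_nf

lemma continuous_circleIntegrand (n : ℕ) {y : ℝ} (hy : 0 < y) :
    Continuous fun x : ℝ ↦ circleIntegrand n (y - x * Complex.I) := by
  have hre (x : ℝ) : (y - x * Complex.I : ℂ).re = y := by simp
  have h (x : ℝ) := (hasSum_circleIntegrand n (s := y - x * Complex.I) (by rwa [hre])).tsum_eq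
  simp_rw [← h]
  refine continuous_tsum (u := fun k ↦ (Fintype.card (Nat.Partition k) : ℝ) *
    Real.exp (-(2 * π * y)) ^ k * Real.exp (2 * π * y * n)) (fun k ↦ by fun_prop)
    (.mul_right _ (summable_card_partition (Real.exp_pos _).le ?_)) fun k x ↦ ?_
  · rw [Real.exp_lt_one_iff]
    have : 0 < 2 * π * y := by positivity
    linarith
  · rw [norm_circle_term, hre]

lemma integral_circleIntegrand (n : ℕ) {y : ℝ} (hy : 0 < y) (a : ℝ) :
    ∫ x in a..(a + 1), circleIntegrand n (y - x * Complex.I) =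
      Fintype.card (Nat.Partition n) := by
  have hre (x : ℝ) : (y - x * Complex.I : ℂ).re = y := by simp
  have h := intervalIntegral.hasSum_integral_of_dominated_convergence (a := a) (b := a + 1)
    (μ := MeasureTheory.volume)
    (F := fun (k : ℕ) (x : ℝ) ↦ (Fintype.card (Nat.Partition k) : ℂ) * Complex.exp
      (2 * π * Complex.I * ((k - n : ℤ) : ℂ) * (Complex.I * (y - x * Complex.I))))
    (f := fun x ↦ circleIntegrand n (y - x * Complex.I))
    (fun k _ ↦ (Fintype.card (Nat.Partition k) : ℝ) *
    Real.exp (-(2 * π * y)) ^ k * Real.exp (2 * π * y * n))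
    (fun k ↦ Continuous.aestronglyMeasurable (by fun_prop))
    (fun k ↦ .of_forall fun x _ ↦ by rw [norm_circle_term, hre])
    (.of_forall fun x _ ↦ .mul_right _ (summable_card_partition (Real.exp_pos _).le (by
      rw [Real.exp_lt_one_iff]
      have : 0 < 2 * π * y := by positivity
      linarith))) (by simp) (.of_forall fun x _ ↦ hasSum_circleIntegrand n (by rwa [hre]))
  simp_rw [intervalIntegral.integral_const_mul, integral_cexp_two_pi_int] at h
  refine h.unique ?_
  refine (hasSum_ite_eq n (Fintype.card (Nat.Partition n) : ℂ)).congr_fun fun k ↦ ?_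
  by_cases hk : k = n
  · simp [hk]
  · have : (k : ℤ) - n ≠ 0 := by omega
    rw [if_neg this, if_neg hk, mul_zero]

lemma sqrt_sqrt_one_add_sq_le_exp (v : ℝ) : √√(1 + v ^ 2) ≤ Real.exp (v ^ 2 / 4) := by
  calc √√(1 + v ^ 2) ≤ √√(Real.exp (v ^ 2)) := by
        gcongr
        linarith [Real.add_one_le_exp (v ^ 2)]
    _ = Real.exp (v ^ 2 / 2 / 2) := by rw [Real.exp_half, Real.exp_half]
    _ = _ := by congr 1; ring

/-- A majorant for the weight of the saddle point near `1 / 2`. -/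
lemma weight_near_half_le {μ v q : ℝ} (hμ : 80 ≤ μ) (hq0 : 0 ≤ q)
    (hq : q * √(1 + v ^ 2) ≤ 1) :
    √(q * √(1 + v ^ 2)) * Real.exp (μ / 2 - μ / 4 * (v ^ 2 / (1 + v ^ 2))) ≤
      √q * Real.exp (μ / 2) * (Real.exp (-((2 * μ / 3 - 1) / 4 * v ^ 2)) +
        1.35 * Real.exp (1 / 2 - μ / 12) * Real.exp (-(1 / 4.5 * v ^ 2))) +
      Real.exp (17 * μ / 52) := by
  have hv0 := sq_nonneg v
  have hpos : 0 < 1 + v ^ 2 := by positivity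
  have hsplit : μ / 4 * (v ^ 2 / (1 + v ^ 2)) = μ / 4 - μ / 4 / (1 + v ^ 2) := by
    field_simp
    ring
  rcases le_total (v ^ 2) (1 / 2) with h | h
  · have h1 : √(q * √(1 + v ^ 2)) * Real.exp (μ / 2 - μ / 4 * (v ^ 2 / (1 + v ^ 2))) ≤
        √q * Real.exp (μ / 2) * Real.exp (-((2 * μ / 3 - 1) / 4 * v ^ 2)) := by
      rw [Real.sqrt_mul hq0]
      have h2 : v ^ 2 * (2 / 3) ≤ v ^ 2 / (1 + v ^ 2) := by
        rw [le_div_iff₀ hpos]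
        nlinarith
      calc _ ≤ √q * Real.exp (v ^ 2 / 4) * Real.exp (μ / 2 - μ / 4 * (v ^ 2 * (2 / 3))) := by
            gcongr
            exact sqrt_sqrt_one_add_sq_le_exp v
        _ = _ := by
          rw [mul_assoc, mul_assoc, ← Real.exp_add, ← Real.exp_add]
          congr 2
          ring
    have h3 : 0 ≤ √q * Real.exp (μ / 2) * (1.35 * Real.exp (1 / 2 - μ / 12) *
      Real.exp (-(1 / 4.5 * v ^ 2))) + Real.exp (17 * μ / 52) := by positivity
    linarith
  rcases le_total (v ^ 2) 2.25 with h' | h'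
  · have h1 : √(q * √(1 + v ^ 2)) * Real.exp (μ / 2 - μ / 4 * (v ^ 2 / (1 + v ^ 2))) ≤
        √q * Real.exp (μ / 2) * (1.35 * Real.exp (1 / 2 - μ / 12) *
          Real.exp (-(1 / 4.5 * v ^ 2))) := by
      rw [Real.sqrt_mul hq0]
      have h2 : 1 / 3 ≤ v ^ 2 / (1 + v ^ 2) := by
        rw [le_div_iff₀ hpos]
        linarith
      have h3 : √√(1 + v ^ 2) ≤ 1.35 := by
        rw [Real.sqrt_le_left (by norm_num), Real.sqrt_le_left (by norm_num)]
        norm_num at h' ⊢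
        linarith
      calc _ ≤ √q * 1.35 * Real.exp (μ / 2 - μ / 4 * (1 / 3)) := by gcongr
        _ ≤ √q * 1.35 * Real.exp (μ / 2 + ((1 / 2 - μ / 12) + -(1 / 4.5 * v ^ 2))) := by
          gcongr
          norm_num at h' ⊢
          linarith
        _ = _ := by
          rw [Real.exp_add, Real.exp_add]
          ring
    have h3 : 0 ≤ √q * Real.exp (μ / 2) * Real.exp (-((2 * μ / 3 - 1) / 4 * v ^ 2)) +
      Real.exp (17 * μ / 52) := by positivity
    linarith
  · have h1 : √(q * √(1 + v ^ 2)) * Real.exp (μ / 2 - μ / 4 * (v ^ 2 / (1 + v ^ 2))) ≤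
        1 * Real.exp (17 * μ / 52) := by
      have h2 : μ / 4 / (1 + v ^ 2) ≤ μ / 13 := by
        rw [div_le_div_iff₀ hpos (by norm_num)]
        norm_num at h'
        nlinarith
      gcongr
      · exact Real.sqrt_le_one.mpr hq
      · rw [hsplit]
        linarith
    have h3 : 0 ≤ √q * Real.exp (μ / 2) * (Real.exp (-((2 * μ / 3 - 1) / 4 * v ^ 2)) +
        1.35 * Real.exp (1 / 2 - μ / 12) * Real.exp (-(1 / 4.5 * v ^ 2))) := by positivity
    linarith

lemma norm_cexp_circle {n : ℕ} {μ y : ℝ} (hμ : 0 < μ) (hn : 2 * π * (n - 1 / 24) = 3 * μ ^ 2 / π)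
    (hy : y = π / (12 * μ)) {s : ℂ} (hs : s.re = y) :
    ‖Complex.exp (2 * π * (n - 1 / 24) * s)‖ = Real.exp (μ / 4) := by
  have : (2 * π * (n - 1 / 24) * s : ℂ) = ((2 * π * (n - 1 / 24) : ℝ) : ℂ) * s := by
    push_cast
    ring
  rw [Complex.norm_exp, this, Complex.re_ofReal_mul, hn, hs, hy]
  congr 1
  field_simp
  norm_num

lemma norm_circleIntegrand_near_half_le {n : ℕ} {μ y : ℝ} (hμ : 80 ≤ μ)
    (hn : 2 * π * (n - 1 / 24) = 3 * μ ^ 2 / π) (hy : y = π / (12 * μ)) (hy' : y ≤ 1 / 200) {x : ℝ}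
    (hx0 : 1 / 4 ≤ x) (hx1 : x ≤ 3 / 4) :
    ‖circleIntegrand n (y - x * Complex.I)‖ ≤
      1.005 * (√(2 * y) * Real.exp (μ / 2) *
        (Real.exp (-((2 * μ / 3 - 1) / 4 * ((x - 1 / 2) / y) ^ 2)) +
        1.35 * Real.exp (1 / 2 - μ / 12) * Real.exp (-(1 / 4.5 * ((x - 1 / 2) / y) ^ 2))) +
      Real.exp (17 * μ / 52)) + minorArcBound y * Real.exp (μ / 4) := by
  have hμ0 : 0 < μ := by linarith
  have hy0 : 0 < y := by rw [hy]; positivity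
  set v := (x - 1 / 2) / y with hv
  set s : ℂ := y - x * Complex.I with hs
  have hre : (Complex.I * s).re = x := by simp [hs]
  have him : (Complex.I * s).im = y := by simp [hs]
  have h := norm_eta_inv_le_near_half (τ := Complex.I * s) (by rwa [him]) (by rwa [him])
    (by rwa [hre]) (by rwa [hre])
  rw [him] at h
  have hvy : v * y = x - 1 / 2 := div_mul_cancel₀ _ hy0.ne'
  have hns : Complex.normSq (2 * (Complex.I * s) - 1) = (2 * y) ^ 2 * (1 + v ^ 2) := by
    have a := Complex.normSq_apply (2 * (Complex.I * s) - 1)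
    have b1 : (2 * (Complex.I * s) - 1).re = 2 * x - 1 := by
      simp [hs]
    have b2 : (2 * (Complex.I * s) - 1).im = 2 * y := by
      simp [hs]
    rw [a, b1, b2]
    linear_combination (-4 * v * y - 4 * (x - 1 / 2)) * hvy
  have hnorm : ‖2 * (Complex.I * s) - 1‖ = 2 * y * √(1 + v ^ 2) := by
    rw [← Real.sqrt_sq (norm_nonneg _), ← Complex.normSq_eq_norm_sq, hns,
      Real.sqrt_mul (by positivity), Real.sqrt_sq (by positivity)]
  have hle1 : 2 * y * √(1 + v ^ 2) ≤ 1 := by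
    rw [← hnorm]
    refine (pow_le_pow_iff_left₀ (norm_nonneg _) (by norm_num) two_ne_zero).mp ?_
    rw [← Complex.normSq_eq_norm_sq, hns]
    have : (v * y) ^ 2 ≤ 1 / 16 := by rw [hvy]; nlinarith
    nlinarith
  have hw := weight_near_half_le hμ (by positivity : 0 ≤ 2 * y) hle1
  unfold circleIntegrand
  rw [norm_mul, norm_cexp_circle hμ0 hn hy (by simp [hs])]
  have hexp : Real.exp (π / 12 * (y / Complex.normSq (2 * (Complex.I * s) - 1))) *
      Real.exp (μ / 4) = Real.exp (μ / 2 - μ / 4 * (v ^ 2 / (1 + v ^ 2))) := by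
    rw [← Real.exp_add, hns]
    congr 1
    rw [hy]
    field_simp
    ring
  rw [hnorm] at h
  calc _ ≤ (1.005 * √(2 * y * √(1 + v ^ 2)) *
        Real.exp (π / 12 * (y / Complex.normSq (2 * (Complex.I * s) - 1))) + minorArcBound y) *
        Real.exp (μ / 4) := by gcongr
    _ = 1.005 * (√(2 * y * √(1 + v ^ 2)) * Real.exp (μ / 2 - μ / 4 * (v ^ 2 / (1 + v ^ 2)))) +
        minorArcBound y * Real.exp (μ / 4) := by rw [← hexp]; ring
    _ ≤ _ := by gcongr

lemma continuous_csqrt_sub_mul_I {y : ℝ} (hy : 0 < y) :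
    Continuous fun x : ℝ ↦ (y - x * Complex.I : ℂ).sqrt := by
  have hre (x : ℝ) : 0 < (y - x * Complex.I : ℂ).re := by simpa
  refine continuous_iff_continuousAt.mpr fun x ↦ ?_
  exact (hasDerivAt_csqrt (hre x)).continuousAt.comp
    (f := fun x : ℝ ↦ (y - x * Complex.I : ℂ)) (by fun_prop)

lemma continuous_saddle_main {A M y : ℝ} (hy : 0 < y) :
    Continuous fun x : ℝ ↦ (y - x * Complex.I : ℂ).sqrt *
        Complex.exp (A ^ 2 / (y - x * Complex.I) + M ^ 2 * (y - x * Complex.I)) := by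
  have h0 (x : ℝ) : (y - x * Complex.I : ℂ) ≠ 0 := by
    intro h
    have : (y - x * Complex.I : ℂ).re = y := by simp
    rw [h] at this
    simp at this
    linarith
  refine (continuous_csqrt_sub_mul_I hy).mul (Complex.continuous_exp.comp ?_)
  exact .add (.div (by fun_prop) (by fun_prop) h0) (by fun_prop)

lemma intervalIntegral_gaussian_le {b y m u v : ℝ} (hb : 0 < b) (hy : 0 < y) (huv : u ≤ v) :
    ∫ x in u..v, Real.exp (-(b * ((x - m) / y) ^ 2)) ≤ y * √(π / b) := by
  have hb' : 0 < b / y ^ 2 := by positivity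
  have e (x : ℝ) : Real.exp (-(b * ((x - m) / y) ^ 2)) = Real.exp (-(b / y ^ 2) * (x - m) ^ 2) := by
    congr 1
    field_simp
  simp_rw [e]
  rw [intervalIntegral.integral_of_le huv]
  have hint : MeasureTheory.Integrable fun x : ℝ ↦ Real.exp (-(b / y ^ 2) * (x - m) ^ 2) :=
    (integrable_exp_neg_mul_sq hb').comp_sub_right m
  refine (MeasureTheory.setIntegral_le_integral hint (.of_forall fun x ↦ (Real.exp_pos _).le)).trans
    (le_of_eq ?_)
  rw [MeasureTheory.integral_sub_right_eq_self (fun x : ℝ ↦ Real.exp (-(b / y ^ 2) * x ^ 2)) m,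
    integral_gaussian, show π / (b / y ^ 2) = y ^ 2 * (π / b) by field_simp,
    Real.sqrt_mul (by positivity), Real.sqrt_sq hy.le]

lemma norm_integral_near_half_le {n : ℕ} {μ y : ℝ} (hμ : 80 ≤ μ)
    (hn : 2 * π * (n - 1 / 24) = 3 * μ ^ 2 / π) (hy : y = π / (12 * μ)) (hy' : y ≤ 1 / 200) :
    ‖∫ x in (1 / 4 : ℝ)..(3 / 4), circleIntegrand n (y - x * Complex.I)‖ ≤
      1.005 * (√(2 * y) * Real.exp (μ / 2) *
        (y * √(π / ((2 * μ / 3 - 1) / 4)) +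
        1.35 * Real.exp (1 / 2 - μ / 12) * (y * √(π / (1 / 4.5)))) +
      Real.exp (17 * μ / 52) * (1 / 2)) + minorArcBound y * Real.exp (μ / 4) * (1 / 2) := by
  have hμ0 : 0 < μ := by linarith
  have hy0 : 0 < y := by rw [hy]; positivity
  have g1 : Continuous fun x : ℝ ↦ Real.exp (-((2 * μ / 3 - 1) / 4 * ((x - 1 / 2) / y) ^ 2)) := by
    fun_prop
  have g2 : Continuous fun x : ℝ ↦ Real.exp (-(1 / 4.5 * ((x - 1 / 2) / y) ^ 2)) := by fun_prop
  refine (intervalIntegral.norm_integral_le_of_norm_le (by norm_num)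
    (.of_forall fun x hx ↦ norm_circleIntegrand_near_half_le hμ hn hy hy' hx.1.le hx.2)
    (Continuous.intervalIntegrable (by fun_prop) _ _)).trans ?_
  rw [intervalIntegral.integral_add (Continuous.intervalIntegrable (by fun_prop) _ _)
      (Continuous.intervalIntegrable (by fun_prop) _ _), intervalIntegral.integral_const_mul,
    intervalIntegral.integral_add (Continuous.intervalIntegrable (by fun_prop) _ _)
      (Continuous.intervalIntegrable (by fun_prop) _ _), intervalIntegral.integral_const_mul,
    intervalIntegral.integral_add (Continuous.intervalIntegrable (by fun_prop) _ _)
      (Continuous.intervalIntegrable (by fun_prop) _ _), intervalIntegral.integral_const_mul,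
    intervalIntegral.integral_const, intervalIntegral.integral_const]
  have i1 := intervalIntegral_gaussian_le (b := (2 * μ / 3 - 1) / 4) (m := 1 / 2) (u := 1 / 4)
    (v := 3 / 4) (by linarith) hy0 (by norm_num)
  have i2 := intervalIntegral_gaussian_le (b := 1 / 4.5) (m := 1 / 2) (u := 1 / 4)
    (v := 3 / 4) (by norm_num) hy0 (by norm_num)
  have e1 : (3 / 4 - 1 / 4 : ℝ) • Real.exp (17 * μ / 52) = Real.exp (17 * μ / 52) * (1 / 2) := by
    rw [smul_eq_mul]; ring
  have e2 : (3 / 4 - 1 / 4 : ℝ) • (minorArcBound y * Real.exp (μ / 4)) =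
      minorArcBound y * Real.exp (μ / 4) * (1 / 2) := by
    rw [smul_eq_mul]; ring
  rw [e1, e2]
  gcongr

lemma norm_integral_near_zero_sub_le {n : ℕ} {A M μ y : ℝ} (hμ : 0 < μ)
    (hA : A ^ 2 = π / 12) (hM : M ^ 2 = 3 * μ ^ 2 / π)
    (hn : 2 * π * (n - 1 / 24) = 3 * μ ^ 2 / π) (hy : y = π / (12 * μ)) (hy' : y ≤ 1 / 200) :
    ‖(∫ x in (-(1 / 4) : ℝ)..(1 / 4), circleIntegrand n (y - x * Complex.I)) -
      ∫ x in (-(1 / 4) : ℝ)..(1 / 4), (y - x * Complex.I : ℂ).sqrt *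
        Complex.exp (A ^ 2 / (y - x * Complex.I) + M ^ 2 * (y - x * Complex.I))‖ ≤
      (minorArcBound y + 1) * Real.exp (μ / 4) * (1 / 2) := by
  have hy0 : 0 < y := by rw [hy]; positivity
  rw [← intervalIntegral.integral_sub
    ((continuous_circleIntegrand n hy0).intervalIntegrable _ _)
    ((continuous_saddle_main hy0).intervalIntegrable _ _)]
  refine (intervalIntegral.norm_integral_le_of_norm_le_const (fun x hx ↦ ?_)
    (C := (minorArcBound y + 1) * Real.exp (μ / 4))).trans (le_of_eq ?_)
  · rw [Set.uIoc_of_le (by norm_num)] at hx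
    set s : ℂ := y - x * Complex.I with hs
    have hre : s.re = y := by simp [hs]
    have him : s.im = -x := by simp [hs]
    have h := norm_eta_inv_sub_le (s := s) (by rwa [hre]) (by rwa [hre])
      (by rw [him, abs_neg, abs_le]; exact ⟨hx.1.le, hx.2⟩)
    rw [hre] at h
    have hAC : (A ^ 2 : ℂ) = π / 12 := by exact_mod_cast hA
    have hMC : (M ^ 2 : ℂ) = 2 * π * (n - 1 / 24) := by
      have := congrArg Complex.ofReal (hM.trans hn.symm)
      push_cast at this
      exact this
    have e : circleIntegrand n s - s.sqrt * Complex.exp (A ^ 2 / s + M ^ 2 * s) =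
        ((ModularForm.eta (Complex.I * s))⁻¹ - s.sqrt * Complex.exp (π / 12 / s)) *
        Complex.exp (2 * π * (n - 1 / 24) * s) := by
      rw [hAC, hMC, Complex.exp_add, circleIntegrand]
      ring
    rw [e, norm_mul, norm_cexp_circle hμ hn hy hre]
    gcongr
  · congr 1
    norm_num

/-- The circle method estimate for the partition function with explicit error terms. -/
lemma abs_card_partition_sub_le_explicit {n : ℕ} {A M μ y : ℝ} (hμ : 80 ≤ μ) (hA0 : 0 ≤ A)
    (hM0 : 0 < M) (hAM : 4 * A ≤ M) (hA : A ^ 2 = π / 12) (hM : M ^ 2 = 3 * μ ^ 2 / π)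
    (hn : 2 * π * (n - 1 / 24) = 3 * μ ^ 2 / π) (hy : y = π / (12 * μ)) (hy' : y ≤ 1 / 200) :
    |(Fintype.card (Nat.Partition n) : ℝ) - √π / M ^ 2 * ((A - 1 / (2 * M)) *
        Real.exp (2 * A * M) - (A + 1 / (2 * M)) * Real.exp (-(2 * A * M)))| ≤
      1.005 * (√(2 * y) * Real.exp (μ / 2) *
        (y * √(π / ((2 * μ / 3 - 1) / 4)) +
        1.35 * Real.exp (1 / 2 - μ / 12) * (y * √(π / (1 / 4.5)))) +
      Real.exp (17 * μ / 52) * (1 / 2)) + minorArcBound y * Real.exp (μ / 4) * (1 / 2) +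
      (minorArcBound y + 1) * Real.exp (μ / 4) * (1 / 2) +
      2 * (1 / M ^ 2 * ((0.52 + √π * (1 / (2 * M) + A)) *
      Real.exp (16 * A ^ 2 * y + M ^ 2 * y))) := by
  have hμ0 : 0 < μ := by linarith
  have hy0 : 0 < y := by rw [hy]; positivity
  have h := integral_circleIntegrand n hy0 (-(1 / 4))
  have hci (u v : ℝ) := (continuous_circleIntegrand n hy0).intervalIntegrable
    (μ := MeasureTheory.volume) u v
  rw [show (-(1 / 4) + 1 : ℝ) = 3 / 4 by norm_num,
    ← intervalIntegral.integral_add_adjacent_intervals (hci _ (1 / 4)) (hci _ _)] at h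
  have h1 := norm_integral_near_half_le hμ hn hy hy'
  have h2 := norm_integral_near_zero_sub_le hμ0 hA hM hn hy hy'
  have h3 := norm_integral_saddle_sub_le hA0 hM0 hy0 hy' hAM
  rw [← Real.norm_eq_abs, ← Complex.norm_real, Complex.ofReal_sub, Complex.ofReal_natCast, ← h]
  refine le_trans ?_ (add_le_add (add_le_add h1 h2) h3)
  refine le_trans (le_of_eq ?_) norm_add₃_le
  congr 1
  ring

lemma exp_neg_natCast_le (k : ℕ) : Real.exp (-k) ≤ 1 / 2.718 ^ k := by
  have : (2.718 : ℝ) ^ k ≤ Real.exp k := by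
    rw [← mul_one (k : ℝ), Real.exp_nat_mul]
    have := Real.exp_one_gt_d9
    gcongr
    linarith
  rw [Real.exp_neg, ← one_div]
  gcongr

lemma pow_mul_exp_neg_le {k : ℕ} {c μ : ℝ} (hc : (k : ℝ) ≤ 80 * c) (hμ : 80 ≤ μ) :
    μ ^ k * Real.exp (-(c * μ)) ≤ 80 ^ k * Real.exp (-(80 * c)) := by
  have h1 : μ ≤ 80 * Real.exp ((μ - 80) / 80) := by
    have := Real.add_one_le_exp ((μ - 80) / 80)
    linarith
  calc μ ^ k * Real.exp (-(c * μ)) ≤ (80 * Real.exp ((μ - 80) / 80)) ^ k *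
        Real.exp (-(c * μ)) := by gcongr
    _ = 80 ^ k * Real.exp (k * ((μ - 80) / 80) - c * μ) := by
      rw [mul_pow, ← Real.exp_nat_mul, mul_assoc, ← Real.exp_add, ← sub_eq_add_neg]
    _ ≤ _ := by
      gcongr
      nlinarith

set_option maxHeartbeats 1600000 in
/-- The circle method estimate for the partition function, for large arguments. -/
lemma abs_card_partition_sub_le {n : ℕ} {μ : ℝ} (hμ : 80 ≤ μ)
    (hn : (24 * n - 1 : ℝ) = 36 * μ ^ 2 / π ^ 2) :
    |(Fintype.card (Nat.Partition n) : ℝ) -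
      √12 / (24 * n - 1) * (1 - 1 / μ) * Real.exp μ| ≤
      0.99 * (√12 / (24 * n - 1)) * Real.exp (μ / 2) := by
  have hμ0 : 0 < μ := by linarith
  have hpi0 := Real.pi_pos
  have hpi1 := Real.pi_gt_d4
  have hpi2 := Real.pi_lt_d4
  have hpi3 : (9.85 : ℝ) ≤ π ^ 2 := by
    norm_num at hpi1 ⊢
    nlinarith
  set A := √(π / 12) with hAdef
  have hA : A ^ 2 = π / 12 := Real.sq_sqrt (by positivity)
  have hA0 : 0 < A := by positivity
  have hA1 : A ≤ 0.512 := by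
    rw [hAdef, Real.sqrt_le_left (by norm_num)]
    norm_num at hpi2 ⊢
    linarith
  set M := μ / (2 * A) with hMdef
  have hM0 : 0 < M := by positivity
  have hM : M ^ 2 = 3 * μ ^ 2 / π := by
    rw [hMdef, div_pow, mul_pow, hA]
    field_simp
    norm_num
  have hAM' : 2 * A * M = μ := by rw [hMdef]; field_simp
  have hM1 : 1 / (2 * M) = A / μ := by rw [hMdef]; field_simp
  have hAμ : A / μ ≤ 0.01 := by
    rw [div_le_iff₀ hμ0]
    norm_num at hA1 ⊢
    linarith
  have hAM : 4 * A ≤ M := by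
    rw [hMdef, le_div_iff₀ (by positivity)]
    nlinarith
  set y := π / (12 * μ) with hy
  have hy0 : 0 < y := by positivity
  have hy1 : y ≤ 0.00328 := by
    rw [hy, div_le_iff₀ (by positivity)]
    norm_num at hpi2 ⊢
    linarith
  have hn' : 2 * π * (n - 1 / 24) = 3 * μ ^ 2 / π := by
    have : (n - 1 / 24 : ℝ) = 36 * μ ^ 2 / π ^ 2 / 24 := by rw [← hn]; ring
    rw [this]
    field_simp
    norm_num
  have key := abs_card_partition_sub_le_explicit hμ hA0.le hM0 hAM hA hM hn' hy (by linarith)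
  have hexp4 : 16 * A ^ 2 * y + M ^ 2 * y ≤ 0.02 + μ / 4 := by
    have : M ^ 2 * y = μ / 4 := by rw [hM, hy]; field_simp; norm_num
    rw [this, hA]
    nlinarith
  rw [hAM', hM1, hM] at key
  rw [hM] at hexp4
  set κ := π ^ 2 / μ ^ 2 with hκ
  have hκ0 : 0 < κ := by positivity
  have hN : 1 / (3 * μ ^ 2 / π) = κ / (3 * π) := by rw [hκ]; field_simp
  have hK : √12 / (24 * n - 1) = √12 / 36 * κ := by rw [hn, hκ]; field_simp
  have h12 : √12 * √12 = 12 := Real.mul_self_sqrt (by norm_num)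
  have h12' : (3.464 : ℝ) ≤ √12 := Real.le_sqrt_of_sq_le (by norm_num)
  have hπA : √π * A = π / √12 := by
    rw [hAdef, ← Real.sqrt_mul hpi0.le, show π * (π / 12) = π ^ 2 / 12 by ring,
      Real.sqrt_div (by positivity), Real.sqrt_sq hpi0.le]
  have hK' : √π / (3 * μ ^ 2 / π) * A = √12 / 36 * κ := by
    rw [div_mul_eq_mul_div, hπA, hκ]
    field_simp
    linear_combination (-3) * h12
  have hmain : √π / (3 * μ ^ 2 / π) * ((A - A / μ) * Real.exp μ - (A + A / μ) * Real.exp (-μ)) =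
      √12 / 36 * κ * (1 - 1 / μ) * Real.exp μ - √12 / 36 * κ * (1 + 1 / μ) * Real.exp (-μ) := by
    rw [← hK']
    ring
  rw [hmain] at key
  rw [hK]
  have hsqrtπ : √π ≤ 1.78 := by
    rw [Real.sqrt_le_left (by norm_num)]
    norm_num at hpi2 ⊢
    linarith
  have h12'' : √12 ≤ 3.465 := by
    rw [Real.sqrt_le_left (by norm_num)]; norm_num
  have e13 : Real.exp (-13) ≤ 0.00000228 := by
    refine (exp_neg_natCast_le 13).trans ?_
    norm_num
  have e11 : Real.exp (-11) ≤ 0.0000168 := by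
    refine (exp_neg_natCast_le 11).trans ?_
    norm_num
  have e6 : Real.exp (-6) ≤ 0.00249 := by
    refine (exp_neg_natCast_le 6).trans ?_
    norm_num
  have decay {c t : ℝ} (hc : (2 : ℝ) ≤ 80 * c) (ht : Real.exp (-(80 * c)) ≤ t) :
      Real.exp (-(c * μ)) ≤ 650 * t * κ := by
    have h := pow_mul_exp_neg_le (k := 2) (by exact_mod_cast hc) hμ
    have ht0 : 0 ≤ t := (Real.exp_pos _).le.trans ht
    rw [hκ, mul_div_assoc', le_div_iff₀ (by positivity), mul_comm]
    refine h.trans ?_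
    calc _ ≤ 80 ^ 2 * t := by gcongr
      _ ≤ 650 * 9.85 * t := by gcongr; norm_num
      _ = 650 * t * 9.85 := by ring
      _ ≤ _ := by gcongr
  -- the contribution of the saddle point at `1 / 2`
  have t1 : √(2 * y) * (y * √(π / ((2 * μ / 3 - 1) / 4))) ≤ 0.08415 * κ := by
    have a1 : √(2 * y) * √(π / ((2 * μ / 3 - 1) / 4)) ≤ π / μ * 1.0097 := by
      rw [← Real.sqrt_mul (by positivity), Real.sqrt_le_left (by positivity), hy]
      have : 0 < 2 * μ / 3 - 1 := by linarith
      rw [div_div_eq_mul_div, mul_div_assoc', div_le_iff₀ this]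
      field_simp
      nlinarith
    calc _ = √(2 * y) * √(π / ((2 * μ / 3 - 1) / 4)) * y := by ring
      _ ≤ π / μ * 1.0097 * y := by gcongr
      _ = 1.0097 / 12 * κ := by rw [hy, hκ]; field_simp
      _ ≤ _ := by gcongr; norm_num
  have t2 : √(2 * y) * (1.35 * Real.exp (1 / 2 - μ / 12) * (y * √(π / (1 / 4.5)))) ≤
      0.0037 * κ := by
    have a1 : √(2 * y) ≤ 0.081 := by
      rw [Real.sqrt_le_left (by norm_num)]
      norm_num at hy1 ⊢
      linarith
    have a2 : √(π / (1 / 4.5)) ≤ 3.77 := by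
      rw [Real.sqrt_le_left (by norm_num)]
      norm_num at hpi2 ⊢
      linarith
    have a3 : Real.exp (1 / 2) ≤ 1.65 := by
      rw [Real.exp_half, Real.sqrt_le_left (by norm_num)]
      have := Real.exp_one_lt_d9
      norm_num at this ⊢
      linarith
    have a4 : Real.exp (1 / 2 - μ / 12) = Real.exp (1 / 2) * Real.exp (-(1 / 12 * μ)) := by
      rw [← Real.exp_add]; ring_nf
    have a5 : y * Real.exp (-(1 / 12 * μ)) ≤ 0.00531 * κ := by
      have b1 := pow_mul_exp_neg_le (k := 1) (c := 1 / 12) (by norm_num) hμ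
      have b2 : Real.exp (-(80 * (1 / 12))) ≤ 0.00249 := by
        refine le_trans (Real.exp_le_exp.mpr ?_) e6
        norm_num
      have b4 : μ ^ 1 * Real.exp (-(1 / 12 * μ)) ≤ 80 ^ 1 * 0.00249 := b1.trans (by gcongr)
      have b3 : y = κ * μ / (12 * π) := by rw [hy, hκ]; field_simp
      rw [b3]
      calc _ = κ / (12 * π) * (μ ^ 1 * Real.exp (-(1 / 12 * μ))) := by ring
        _ ≤ κ / (12 * π) * (80 ^ 1 * 0.00249) :=
          mul_le_mul_of_nonneg_left b4 (by positivity)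
        _ = 80 * 0.00249 / (12 * π) * κ := by ring
        _ ≤ _ := by
          gcongr
          rw [div_le_iff₀ (by positivity)]
          norm_num at hpi1 ⊢
          linarith
    rw [a4]
    calc _ = √(2 * y) * (1.35 * Real.exp (1 / 2) * (y * Real.exp (-(1 / 12 * μ))) *
          √(π / (1 / 4.5))) := by ring
      _ ≤ 0.081 * (1.35 * 1.65 * (0.00531 * κ) * 3.77) := by gcongr
      _ ≤ _ := by linarith
  have t3 : Real.exp (17 * μ / 52) ≤ 0.00149 * κ * Real.exp (μ / 2) := by
    have := decay (c := 9 / 52) (t := 0.00000228) (by norm_num)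
      (le_trans (Real.exp_le_exp.mpr (by norm_num)) e13)
    calc _ = Real.exp (-(9 / 52 * μ)) * Real.exp (μ / 2) := by rw [← Real.exp_add]; ring_nf
      _ ≤ _ := by
        gcongr
        refine this.trans ?_
        gcongr
        norm_num
  have t4 : Real.exp (μ / 4) ≤ 0.00149 * κ * Real.exp (μ / 2) := by
    have := decay (c := 1 / 4) (t := 0.00000228) (by norm_num)
      (le_trans (Real.exp_le_exp.mpr (by norm_num)) e13)
    calc _ = Real.exp (-(1 / 4 * μ)) * Real.exp (μ / 2) := by rw [← Real.exp_add]; ring_nf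
      _ ≤ _ := by
        gcongr
        refine this.trans ?_
        gcongr
        norm_num
  have t5 : minorArcBound y * Real.exp (μ / 4) ≤ 0.0029 * κ * Real.exp (μ / 2) := by
    have := decay (c := 5 / 36) (t := 0.0000168) (by norm_num)
      (le_trans (Real.exp_le_exp.mpr (by norm_num)) e11)
    have a1 : √√y ≤ 0.24 := by
      rw [Real.sqrt_le_left (by norm_num), Real.sqrt_le_left (by norm_num)]
      norm_num at hy1 ⊢
      linarith
    have a2 : π / (108 * y) = μ / 9 := by rw [hy]; field_simp; norm_num
    rw [minorArcBound, a2]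
    calc _ = 1.09 * √√y * (Real.exp (-(5 / 36 * μ)) * Real.exp (μ / 2)) := by
          rw [mul_assoc, ← Real.exp_add, ← Real.exp_add]; ring_nf
      _ ≤ 1.09 * 0.24 * (650 * 0.0000168 * κ * Real.exp (μ / 2)) := by gcongr
      _ = 1.09 * 0.24 * (650 * 0.0000168) * κ * Real.exp (μ / 2) := by ring
      _ ≤ _ := by gcongr; norm_num
  have e002 : Real.exp 0.02 ≤ 1.03 := by
    refine (Real.exp_bound_div_one_sub_of_interval (by norm_num) (by norm_num)).trans ?_
    norm_num
  have hκ1 : κ ≤ 0.002 := by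
    rw [hκ, div_le_iff₀ (by positivity)]
    nlinarith
  have t6 : 1 / (3 * μ ^ 2 / π) * ((0.52 + √π * (A / μ + A)) *
      Real.exp (16 * A ^ 2 * y + 3 * μ ^ 2 / π * y)) ≤ 0.0001 * κ * Real.exp (μ / 2) := by
    rw [hN]
    have a1 : κ / (3 * π) ≤ 0.000213 := by
      rw [div_le_iff₀ (by positivity)]
      norm_num at hpi1 hκ1 ⊢
      linarith
    calc _ ≤ 0.000213 * ((0.52 + 1.78 * (0.01 + 0.512)) *
          (1.03 * (0.00149 * κ * Real.exp (μ / 2)))) := by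
          gcongr
          refine (Real.exp_le_exp.mpr hexp4).trans ?_
          rw [Real.exp_add]
          gcongr
      _ = 0.000213 * ((0.52 + 1.78 * (0.01 + 0.512)) * (1.03 * 0.00149)) *
          κ * Real.exp (μ / 2) := by ring
      _ ≤ _ := by gcongr; norm_num
  have t7 : √12 / 36 * κ * (1 + 1 / μ) * Real.exp (-μ) ≤ 0.0001 * κ * Real.exp (μ / 2) := by
    have a1 : 1 / μ ≤ 1 := by rw [div_le_one hμ0]; linarith
    have a2 : Real.exp (-μ) ≤ 0.00149 * κ * Real.exp (μ / 2) := by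
      refine le_trans (Real.exp_le_exp.mpr ?_) t4
      linarith
    calc _ ≤ 3.465 / 36 * 0.002 * (1 + 1) * (0.00149 * κ * Real.exp (μ / 2)) := by gcongr
      _ = 3.465 / 36 * 0.002 * (1 + 1) * 0.00149 * κ * Real.exp (μ / 2) := by ring
      _ ≤ _ := by gcongr; norm_num
  have hE : 0 < κ * Real.exp (μ / 2) := by positivity
  have hK0 : 0.0952 * (κ * Real.exp (μ / 2)) ≤ 0.99 * (√12 / 36 * κ) * Real.exp (μ / 2) := by
    nlinarith
  have s1 := mul_le_mul_of_nonneg_right t1 (Real.exp_pos (μ / 2)).le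
  have s2 := mul_le_mul_of_nonneg_right t2 (Real.exp_pos (μ / 2)).le
  have t7' : 0 ≤ √12 / 36 * κ * (1 + 1 / μ) * Real.exp (-μ) := by positivity
  rw [abs_le] at key ⊢
  constructor
  · linarith [key.1]
  · linarith [key.2]

section
open PowerSeries PowerSeries.WithPiTopology

lemma mk_card_partition_mul_pentagonalSeries :
    (PowerSeries.mk fun n ↦ (Fintype.card (Nat.Partition n) : ℤ)) * pentagonalSeries ℤ = 1 := by
  have h (n : ℕ) : Fintype.card (Nat.Partition n) =
      #(Nat.Partition.restricted n (fun _ ↦ True)) := by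
    simp [Nat.Partition.restricted, Finset.card_univ]
  simp_rw [h]
  have hm := Nat.Partition.multipliable_powerSeriesMk_card_restricted ℤ (fun _ ↦ True)
  rw [Nat.Partition.powerSeriesMk_card_restricted_eq_tprod, ← tprod_one_sub_X_pow,
    ← hm.tprod_mul (multipliable_one_sub_X_pow ℤ)]
  refine (tprod_congr fun i ↦ ?_).trans tprod_one
  rw [if_pos trivial]
  simp_rw [pow_mul]
  exact tsum_pow_mul_one_sub_of_constantCoeff_eq_zero (by simp)

/-- Evaluation at `B` of the pentagonal series, truncated to the indices in `[-25, 25]`. -/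
def pentagonalEval (B : ℕ) : ℤ :=
  ∑ i ∈ range 51, if i % 2 = 1 then ((B ^ pentagonal (i - 25) : ℕ) : ℤ)
    else -((B ^ pentagonal (i - 25) : ℕ) : ℤ)

lemma pentagonal_lt_iff (j : ℤ) : pentagonal j < 973 ↔ j ∈ Icc (-25 : ℤ) 25 := by
  have h := two_mul_natCast_pentagonal j
  rw [Finset.mem_Icc]
  constructor
  · intro hj
    have : (pentagonal j : ℤ) < 973 := by exact_mod_cast hj
    constructor <;> by_contra! hc <;> nlinarith
  · rintro ⟨h1, h2⟩
    have : (pentagonal j : ℤ) < 973 := by nlinarith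
    exact_mod_cast this

lemma eval_trunc_pentagonalSeries (B : ℕ) :
    (trunc 973 (pentagonalSeries ℤ)).eval (B : ℤ) = pentagonalEval B := by
  rw [Polynomial.eval, eval₂_trunc_eq_sum_range, pentagonalEval]
  symm
  refine Finset.sum_of_injOn (fun i : ℕ ↦ pentagonal (i - 25)) ?_ ?_ ?_ ?_
  · intro i _ j _ hij
    have := pentagonal_injective hij
    omega
  · intro i hi
    have hi : i < 51 := by simpa using hi
    simpa using (pentagonal_lt_iff (i - 25)).mpr (Finset.mem_Icc.mpr ⟨by omega, by omega⟩)
  · intro d hd hd'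
    rw [coeff_pentagonalSeries_eq_zero]
    · simp
    · rintro ⟨j, rfl⟩
      rw [Finset.mem_range] at hd
      have hj := Finset.mem_Icc.mp ((pentagonal_lt_iff j).mp hd)
      refine hd' ⟨(j + 25).toNat, ?_, ?_⟩
      · simp only [Finset.coe_range, Set.mem_Iio]
        omega
      · simp only
        congr 1
        omega
  · intro i _
    rw [coeff_pentagonalSeries_pentagonal]
    split_ifs with h
    · rw [Int.negOnePow_even _ (Int.even_iff.mpr (by omega))]; simp
    · rw [Int.negOnePow_odd _ (Int.odd_iff.mpr (by omega))]; simp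

lemma pow_dvd_eval_trunc_mul_sub (f g : ℤ⟦X⟧) (M : ℕ) (b : ℤ) :
    b ^ M ∣ (trunc M f).eval b * (trunc M g).eval b - (trunc M (f * g)).eval b := by
  have : (Polynomial.X : Polynomial ℤ) ^ M ∣ trunc M f * trunc M g - trunc M (f * g) := by
    rw [Polynomial.X_pow_dvd_iff]
    intro d hd
    rw [Polynomial.coeff_sub, ← trunc_trunc_mul_trunc, coeff_trunc, if_pos hd,
      ← Polynomial.coe_mul, Polynomial.coeff_coe, sub_self]
  simpa using Polynomial.eval_dvd (x := b) this

lemma pow_dvd_sum_card_partition_mul (B : ℕ) :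
    (B : ℤ) ^ 973 ∣ (∑ n ∈ range 973, (Fintype.card (Nat.Partition n) : ℤ) * B ^ n) *
      pentagonalEval B - 1 := by
  have h := pow_dvd_eval_trunc_mul_sub
    (PowerSeries.mk fun n ↦ (Fintype.card (Nat.Partition n) : ℤ)) (pentagonalSeries ℤ) 973 B
  rw [mk_card_partition_mul_pentagonalSeries, eval_trunc_pentagonalSeries, Polynomial.eval,
    eval₂_trunc_eq_sum_range] at h
  simpa using h

end

lemma sum_mul_pow_lt {B : ℕ} (a : ℕ → ℕ) (M : ℕ) (ha : ∀ i < M, a i < B) :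
    ∑ i ∈ range M, a i * B ^ i < B ^ M := by
  induction M with
  | zero => simp
  | succ M ih =>
    rw [Finset.sum_range_succ, pow_succ]
    have h1 := ih fun i hi ↦ ha i (by omega)
    have h2 : (a M + 1) * B ^ M ≤ B * B ^ M := Nat.mul_le_mul_right _ (ha M (by omega))
    linarith

lemma eq_sum_card_partition {P : ℕ} (hP : P < (2 ^ 972) ^ 973)
    (h : ((2 ^ 972 : ℕ) : ℤ) ^ 973 ∣ P * pentagonalEval (2 ^ 972) - 1) :
    P = ∑ n ∈ range 973, Fintype.card (Nat.Partition n) * (2 ^ 972) ^ n := by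
  have hlt : ∑ n ∈ range 973, Fintype.card (Nat.Partition n) * (2 ^ 972) ^ n <
      (2 ^ 972) ^ 973 := by
    refine sum_mul_pow_lt _ _ fun i hi ↦ (card_partition_le i).trans_lt ?_
    exact Nat.pow_lt_pow_right (by norm_num) (by omega)
  have h' := pow_dvd_sum_card_partition_mul (2 ^ 972)
  generalize hB : 2 ^ 972 = B at *
  generalize hG : ∑ n ∈ range 973, Fintype.card (Nat.Partition n) * B ^ n = G at *
  have hG' : (∑ n ∈ range 973, (Fintype.card (Nat.Partition n) : ℤ) * (B : ℤ) ^ n) = G := by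
    rw [← hG]; push_cast; rfl
  rw [hG'] at h'
  generalize pentagonalEval B = e at *
  have hd : (B : ℤ) ^ 973 ∣ (P : ℤ) - G := by
    have : (P : ℤ) - G = G * (P * e - 1) - P * (G * e - 1) := by ring
    rw [this]
    exact (h.mul_left _).sub (h'.mul_left _)
  have hmod : G ≡ P [MOD B ^ 973] := by
    rw [Nat.modEq_iff_dvd]
    exact_mod_cast hd
  exact (Nat.ModEq.eq_of_lt_of_lt hmod hlt hP).symm

/-- Function application, arranged so that kernel reduction evaluates the argument first. -/
def forceEval {α : Type} (x : ℕ) (f : ℕ → α) : α := Nat.rec (f 0) (fun k _ ↦ f (k + 1)) x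

@[simp] lemma forceEval_eq {α : Type} (x : ℕ) (f : ℕ → α) : forceEval x f = f x := by
  cases x <;> rfl

/-- Tests all of the `M` lowest base-`B` digits of a number, counting positions from `k`. -/
def allDigits (B : ℕ) (t : ℕ → ℕ → Bool) (M : ℕ) : ℕ → ℕ → Bool :=
  Nat.rec (fun _ _ ↦ true)
    (fun _ ih k P ↦ forceEval k fun k ↦
      (forceEval (P % B) fun d ↦ t k d) && forceEval (P / B) fun P ↦ ih (k + 1) P) M

lemma allDigits_sum {B : ℕ} {t : ℕ → ℕ → Bool} {a : ℕ → ℕ} {M : ℕ} :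
    ∀ {k : ℕ}, (∀ i < M, a (k + i) < B) →
      allDigits B t M k (∑ i ∈ range M, a (k + i) * B ^ i) = true →
        ∀ i < M, t (k + i) (a (k + i)) = true := by
  induction M with
  | zero => intro _ _ _ i hi; omega
  | succ M ih =>
    intro k ha h i hi
    have hB : 0 < B := (Nat.zero_le _).trans_lt (ha 0 (by omega))
    have h0 : a k < B := ha 0 (by omega)
    have hsum : ∑ i ∈ range (M + 1), a (k + i) * B ^ i =
        a k + B * ∑ i ∈ range M, a (k + 1 + i) * B ^ i := by
      rw [Finset.sum_range_succ', Finset.mul_sum, add_comm]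
      congr 1
      · simp
      · refine Finset.sum_congr rfl fun i _ ↦ ?_
        rw [pow_succ, show k + (i + 1) = k + 1 + i by ring]
        ring
    have hstep : allDigits B t (M + 1) k (∑ i ∈ range (M + 1), a (k + i) * B ^ i) =
        (t k ((∑ i ∈ range (M + 1), a (k + i) * B ^ i) % B) &&
          allDigits B t M (k + 1) ((∑ i ∈ range (M + 1), a (k + i) * B ^ i) / B)) := by
      simp [allDigits]
    rw [hstep, hsum, Nat.add_mul_mod_self_left, Nat.add_mul_div_left _ _ hB,
      Nat.mod_eq_of_lt h0, Nat.div_eq_of_lt h0, zero_add, Bool.and_eq_true] at h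
    rcases i with _ | i
    · exact h.1
    · rw [show k + (i + 1) = k + 1 + i by ring]
      refine ih (fun i hi ↦ ?_) h.2 i (by omega)
      rw [show k + 1 + i = k + (i + 1) by ring]
      exact ha _ (by omega)

/-- The `2 ^ k`-th power of a fixed-point number of scale `S`, rounded down after each squaring. -/
def squareIter (S k : ℕ) : ℕ → ℕ :=
  Nat.rec (fun x ↦ x) (fun _ ih x ↦ forceEval (x * x / S) ih) k

lemma squareIter_le {S : ℕ} (hS : 0 < S) {k : ℕ} : ∀ {x : ℕ} {a : ℝ}, (x : ℝ) ≤ S * a →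
    (squareIter S k x : ℝ) ≤ S * a ^ 2 ^ k := by
  have hS' : (0 : ℝ) < S := by exact_mod_cast hS
  induction k with
  | zero => intro x a h; simpa [squareIter] using h
  | succ k ih =>
    intro x a h
    have hstep : squareIter S (k + 1) x = squareIter S k (x * x / S) := by simp [squareIter]
    rw [hstep, pow_succ', pow_mul]
    refine ih (Nat.cast_div_le.trans ?_)
    rw [div_le_iff₀ hS', Nat.cast_mul]
    calc (x : ℝ) * x ≤ S * a * (S * a) :=
          mul_le_mul h h (by positivity) ((Nat.cast_nonneg x).trans h)
      _ = _ := by ring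

/-- Newton iteration for the integer square root. -/
def newtonSqrt (N k : ℕ) : ℕ → ℕ :=
  Nat.rec (fun x ↦ x) (fun _ ih x ↦ forceEval ((x + N / x) / 2) ih) k

/-- Fixed-point verification of the bounds of `abs_sub_le_of_boundTest`, where `s`, `mlo`, `mhi`
approximate `√(24 * n - 1)` and `μ = π * √(24 * n - 1) / 6`, while `h`, `e` and `f` are lower bounds
for `exp (μ / 2)`, `exp μ` and `exp (-μ)`, all in units of `1 / S`. -/
def boundTest (S T n p : ℕ) : Bool :=
  forceEval (newtonSqrt ((24 * n - 1) * S ^ 2) 16 (S * 160)) fun s ↦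
  forceEval (314159265358979323846 * s / (6 * 10 ^ 20)) fun mlo ↦
  forceEval (314159265358979323847 * (s + 1) / (6 * 10 ^ 20) + 1) fun mhi ↦
  forceEval (squareIter S 71 (S + mlo / 2 ^ 72)) fun h ↦
  forceEval (h * h / S) fun e ↦
  forceEval (squareIter S 72 (S - (mhi / 2 ^ 72 + 1))) fun f ↦
    Nat.ble (s * s) ((24 * n - 1) * S ^ 2) &&
    Nat.ble ((24 * n - 1) * S ^ 2) ((s + 1) * (s + 1)) &&
    Nat.ble S mlo && Nat.ble (mhi / 2 ^ 72 + 1) S &&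
    Nat.ble (p * (T + 1) * (24 * n - 1) * mlo * (24 * n) + S * e * (24 * n))
      (mlo * e * (24 * n) + (24 * n - 1) * h * mlo) &&
    Nat.ble (mhi * S * S * (24 * n))
      (mhi * f * (p * T * (24 * n - 1) * (24 * n) + (24 * n - 1) * h) + S * S * S * (24 * n))

lemma abs_sub_le_of_fixedPoint {S R N p T lo hi h e f μ E H q : ℝ} (hS : 0 < S) (hR : 0 < R)
    (hN : 0 < N) (hp : 0 ≤ p) (hq : 0 < q) (hT1 : T * q ≤ S) (hT2 : S ≤ (T + 1) * q)
    (hlo : S ≤ lo) (hlo' : lo ≤ μ * S) (hhi : μ * S ≤ hi) (hH : h ≤ S * H) (hE : e ≤ S * E)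
    (hE0 : 0 < E) (hf : f * E ≤ S) (hh0 : 0 ≤ h) (hT0 : 0 ≤ T)
    (h1 : p * (T + 1) * R * lo * N + S * e * N ≤ lo * e * N + R * h * lo)
    (h2 : hi * S * S * N ≤ hi * f * (p * T * R * N + R * h) + S * S * S * N) :
    |p - q / R * (1 - 1 / μ) * E| ≤ q / N * H := by
  have hlo0 : 0 < lo := hS.trans_le hlo
  have hμ : 0 < μ := pos_of_mul_pos_left (hlo0.trans_le hlo') hS.le
  have hhi0 : 0 < hi := (mul_pos hμ hS).trans_le hhi
  have hμlo : 1 / μ ≤ S / lo := by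
    rw [div_le_div_iff₀ hμ hlo0]; linarith
  have hμhi : S / hi ≤ 1 / μ := by
    rw [div_le_div_iff₀ hhi0 hμ]; linarith
  have hlo1 : 0 ≤ 1 - S / lo := by
    rw [sub_nonneg, div_le_one hlo0]; exact hlo
  have hA : p * R * N * S ≤ q * ((1 - 1 / μ) * (S * E) * N + R * (S * H)) := by
    have a1 : p * (T + 1) * R * N ≤ (1 - S / lo) * e * N + R * h := by
      have : (1 - S / lo) * e * N + R * h = (lo * e * N + R * h * lo - S * e * N) / lo := by
        field_simp
        ring
      rw [this, le_div_iff₀ hlo0]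
      linarith
    calc p * R * N * S ≤ p * R * N * ((T + 1) * q) := by gcongr
      _ = q * (p * (T + 1) * R * N) := by ring
      _ ≤ q * ((1 - S / lo) * e * N + R * h) := by gcongr
      _ ≤ q * ((1 - S / lo) * (S * E) * N + R * (S * H)) := by gcongr
      _ ≤ _ := by gcongr
  have hB : q * ((1 - 1 / μ) * (S * E) * N) ≤ p * R * N * S + q * (R * (S * H)) := by
    have b1 : (1 - S / hi) * S * S * N ≤ f * (p * T * R * N + R * h) := by
      have : (1 - S / hi) * S * S * N = (hi * S * S * N - S * S * S * N) / hi := by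
        field_simp
      rw [this, div_le_iff₀ hhi0]
      linarith
    have b2 : (1 - S / hi) * (S * E) * N ≤ p * T * R * N + R * h := by
      refine le_of_mul_le_mul_left ?_ hS
      calc S * ((1 - S / hi) * (S * E) * N) = (1 - S / hi) * S * S * N * E := by ring
        _ ≤ f * (p * T * R * N + R * h) * E := by gcongr
        _ = f * E * (p * T * R * N + R * h) := by ring
        _ ≤ _ := by gcongr
    calc _ ≤ q * ((1 - S / hi) * (S * E) * N) := by gcongr
      _ ≤ q * (p * T * R * N + R * h) := by gcongr
      _ = p * R * N * (T * q) + q * (R * h) := by ring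
      _ ≤ _ := by gcongr
  have hA' : p * (R * N) ≤ q * ((1 - 1 / μ) * E * N + R * H) := by
    refine le_of_mul_le_mul_right ?_ hS
    linarith
  have hB' : q * ((1 - 1 / μ) * E * N) ≤ p * (R * N) + q * (R * H) := by
    refine le_of_mul_le_mul_right ?_ hS
    linarith
  have hRN : 0 < R * N := mul_pos hR hN
  rw [abs_sub_le_iff, sub_le_iff_le_add, sub_le_iff_le_add]
  constructor
  · refine le_of_mul_le_mul_right ?_ hRN
    calc _ ≤ _ := hA'
      _ = _ := by field_simp; ring
  · refine le_of_mul_le_mul_right ?_ hRN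
    calc _ = q * ((1 - 1 / μ) * E * N) := by field_simp
      _ ≤ _ := hB'
      _ = _ := by field_simp; ring

lemma natCast_div_le_div_add_one (a b : ℕ) : (a / b : ℝ) ≤ ((a / b + 1 : ℕ) : ℝ) := by
  rw [← Nat.floor_div_eq_div (K := ℝ), Nat.cast_add_one]
  exact (Nat.lt_floor_add_one _).le

lemma abs_sub_le_of_boundTest {S T n p : ℕ} (hn : 1 ≤ n) (hS : 0 < S)
    (hT1 : (T : ℝ) * √12 ≤ S) (hT2 : (S : ℝ) ≤ (T + 1) * √12) (h : boundTest S T n p = true) :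
    |(p : ℝ) - √12 / (24 * n - 1) * (1 - 1 / (π * √(24 * n - 1) / 6)) *
      Real.exp (π * √(24 * n - 1) / 6)| ≤
      √12 / (24 * n) * Real.exp (π * √(24 * n - 1) / 6 / 2) := by
  have hS' : (0 : ℝ) < S := by exact_mod_cast hS
  have hn' : (1 : ℝ) ≤ n := by exact_mod_cast hn
  have hR : ((24 * n - 1 : ℕ) : ℝ) = 24 * n - 1 := by
    rw [Nat.cast_sub (by omega)]; push_cast; ring
  simp only [boundTest, forceEval_eq, Bool.and_eq_true, Nat.ble_eq] at h
  generalize newtonSqrt ((24 * n - 1) * S ^ 2) 16 (S * 160) = s at h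
  have hlo : ((314159265358979323846 * s / (6 * 10 ^ 20) : ℕ) : ℝ) ≤
      314159265358979323846 * s / (6 * 10 ^ 20) := by
    refine Nat.cast_div_le.trans (le_of_eq ?_)
    push_cast; ring
  have hhi : (314159265358979323847 * (s + 1) / (6 * 10 ^ 20) : ℝ) ≤
      ((314159265358979323847 * (s + 1) / (6 * 10 ^ 20) + 1 : ℕ) : ℝ) := by
    refine le_trans (le_of_eq ?_) (natCast_div_le_div_add_one _ _)
    push_cast; ring
  generalize 314159265358979323846 * s / (6 * 10 ^ 20) = lo at h hlo
  generalize 314159265358979323847 * (s + 1) / (6 * 10 ^ 20) + 1 = hi at h hhi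
  obtain ⟨⟨⟨⟨⟨h1, h2⟩, h3⟩, h4⟩, h6⟩, h7⟩ := h
  set r : ℝ := √(24 * n - 1) with hr
  have hr2 : r ^ 2 = 24 * n - 1 := Real.sq_sqrt (by linarith)
  have hr0 : 0 ≤ r := Real.sqrt_nonneg _
  have h1' : (s : ℝ) ≤ r * S := by
    refine le_of_sq_le_sq ?_ (by positivity)
    rw [mul_pow, hr2, ← hR]
    exact_mod_cast (sq s).le.trans h1
  have h2' : r * S ≤ s + 1 := by
    refine le_of_sq_le_sq ?_ (by positivity)
    rw [mul_pow, hr2, ← hR]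
    exact_mod_cast h2.trans (sq (s + 1)).ge
  have hpi1 := Real.pi_gt_d20
  have hpi2 := Real.pi_lt_d20
  set μ := π * r / 6 with hμ
  have hlo' : (lo : ℝ) ≤ μ * S := by
    refine hlo.trans ?_
    calc (314159265358979323846 * s / (6 * 10 ^ 20) : ℝ) = 3.14159265358979323846 * s / 6 := by
          ring
      _ ≤ π * (r * S) / 6 := by gcongr
      _ = _ := by rw [hμ]; ring
  have hhi' : μ * S ≤ hi := by
    refine le_trans ?_ hhi
    calc μ * S = π * (r * S) / 6 := by rw [hμ]; ring
      _ ≤ 3.14159265358979323847 * (s + 1) / 6 := by gcongr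
      _ = _ := by ring
  have hμ0 : 0 ≤ μ := by positivity
  have hhalf : ((squareIter S 71 (S + lo / 2 ^ 72) : ℕ) : ℝ) ≤ S * Real.exp (μ / 2) := by
    have : μ / 2 = ((2 ^ 71 : ℕ) : ℝ) * (μ / 2 ^ 72) := by push_cast; ring
    rw [this, Real.exp_nat_mul]
    refine squareIter_le hS ?_
    have a1 : ((lo / 2 ^ 72 : ℕ) : ℝ) ≤ lo / 2 ^ 72 := by
      refine Nat.cast_div_le.trans (le_of_eq ?_)
      push_cast; ring
    have a2 := Real.add_one_le_exp (μ / 2 ^ 72)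
    push_cast
    calc (S : ℝ) + ((lo / 2 ^ 72 : ℕ) : ℝ) ≤ S + μ * S / 2 ^ 72 := by
          gcongr
          exact a1.trans (by gcongr)
      _ = S * (μ / 2 ^ 72 + 1) := by ring
      _ ≤ _ := by gcongr
  have hneg : ((squareIter S 72 (S - (hi / 2 ^ 72 + 1)) : ℕ) : ℝ) ≤ S * Real.exp (-μ) := by
    have : -μ = ((2 ^ 72 : ℕ) : ℝ) * (-(μ / 2 ^ 72)) := by push_cast; ring
    rw [this, Real.exp_nat_mul]
    refine squareIter_le hS ?_
    rw [Nat.cast_sub h4]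
    have a1 : (hi / 2 ^ 72 : ℝ) ≤ ((hi / 2 ^ 72 + 1 : ℕ) : ℝ) := by
      refine le_trans (le_of_eq ?_) (natCast_div_le_div_add_one _ _)
      push_cast; ring
    have a2 := Real.add_one_le_exp (-(μ / 2 ^ 72))
    calc (S : ℝ) - ((hi / 2 ^ 72 + 1 : ℕ) : ℝ) ≤ S - μ * S / 2 ^ 72 := by
          gcongr
          exact le_trans (by gcongr) a1
      _ = S * (-(μ / 2 ^ 72) + 1) := by ring
      _ ≤ _ := by gcongr
  generalize squareIter S 71 (S + lo / 2 ^ 72) = H at *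
  generalize squareIter S 72 (S - (hi / 2 ^ 72 + 1)) = F at *
  have hfull : ((H * H / S : ℕ) : ℝ) ≤ S * Real.exp μ := by
    refine Nat.cast_div_le.trans ?_
    rw [div_le_iff₀ hS', Nat.cast_mul]
    calc (H * H : ℝ) ≤ S * Real.exp (μ / 2) * (S * Real.exp (μ / 2)) := by gcongr
      _ = S * (Real.exp (μ / 2) * Real.exp (μ / 2)) * S := by ring
      _ = _ := by rw [← Real.exp_add, add_halves]
  generalize H * H / S = e at *
  refine abs_sub_le_of_fixedPoint (S := S) (T := T) (lo := lo) (hi := hi) (h := H) (e := e) (f := F)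
    hS' (by linarith) (by positivity) (Nat.cast_nonneg _) (by positivity) hT1 hT2
    (by exact_mod_cast h3) hlo' hhi' hhalf hfull (Real.exp_pos _) ?_
    (Nat.cast_nonneg _) (Nat.cast_nonneg _) ?_ ?_
  · calc (F : ℝ) * Real.exp μ ≤ S * Real.exp (-μ) * Real.exp μ := by gcongr
      _ = S := by rw [mul_assoc, ← Real.exp_add]; simp
  · rw [← hR]; exact_mod_cast h6
  · rw [← hR]; exact_mod_cast h7

/-- Newton iteration for the inverse of `e` modulo `N`. -/
def newtonInverse (e N k : ℕ) : ℕ :=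
  Nat.rec (fun x ↦ x) (fun _ ih x ↦ forceEval (x * (N + 2 - e * x % N) % N) ih) k 1

/-- The numbers of partitions of `0, …, 972`, as the digits of a number in base `2 ^ 972`. -/
def partitionDigits : ℕ :=
  forceEval ((2 ^ 972) ^ 973) fun N ↦
    forceEval (pentagonalEval (2 ^ 972) % N).toNat fun e ↦ newtonInverse e N 10

lemma partitionDigits_spec : (forceEval partitionDigits fun P ↦
    Nat.blt P ((2 ^ 972) ^ 973) &&
      Int.beq' ((P * pentagonalEval (2 ^ 972) - 1) % (((2 ^ 972) ^ 973 : ℕ) : ℤ)) 0) = true := by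
  decide +kernel

set_option exponentiation.threshold 1000 in
lemma partitionDigits_eq :
    partitionDigits =
      ∑ n ∈ range 973, Fintype.card (Nat.Partition n) * (2 ^ 972) ^ n := by
  have h := partitionDigits_spec
  rw [forceEval_eq, Bool.and_eq_true, Nat.blt_eq, Int.beq'_eq] at h
  refine eq_sum_card_partition h.1 ?_
  rw [← Nat.cast_pow]
  exact Int.dvd_of_emod_eq_zero h.2

/-- The combined finite verification; `T` is an approximation to `2 ^ 200 / √12`. -/
def finiteTest : Bool :=
  forceEval (2 ^ 200) fun S ↦ forceEval (2 ^ 972) fun B ↦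
    forceEval (newtonSqrt (S ^ 2 / 12) 10 S) fun T ↦
      Nat.ble (12 * T ^ 2) (S ^ 2) && Nat.ble (S ^ 2) (12 * (T + 1) ^ 2) &&
        allDigits B (fun n p ↦ Nat.beq n 0 || boundTest S T n p) 973 0 partitionDigits

lemma finiteTest_eq : finiteTest = true := by decide +kernel

lemma abs_card_partition_sub_le_of_lt {n : ℕ} (hn : 1 ≤ n) (hn' : n < 973) :
    |(Fintype.card (Nat.Partition n) : ℝ) - √12 / (24 * n - 1) *
      (1 - 1 / (π * √(24 * n - 1) / 6)) * Real.exp (π * √(24 * n - 1) / 6)| ≤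
      √12 / (24 * n) * Real.exp (π * √(24 * n - 1) / 6 / 2) := by
  have h := finiteTest_eq
  have hS : 0 < 2 ^ 200 := by positivity
  have hB (i : ℕ) (hi : i < 973) : Fintype.card (Nat.Partition (0 + i)) < 2 ^ 972 := by
    rw [zero_add]
    refine (card_partition_le i).trans_lt (Nat.pow_lt_pow_right (by norm_num) (by omega))
  have heq := partitionDigits_eq
  simp only [finiteTest, forceEval_eq] at h
  generalize 2 ^ 200 = S at h hS
  generalize 2 ^ 972 = B at h hB heq
  generalize newtonSqrt (S ^ 2 / 12) 10 S = T at h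
  rw [Bool.and_eq_true, Bool.and_eq_true, Nat.ble_eq, Nat.ble_eq, heq] at h
  obtain ⟨⟨h1, h2⟩, h3⟩ := h
  have h4 := allDigits_sum (a := fun i ↦ Fintype.card (Nat.Partition i)) (k := 0) hB
    (by simpa only [zero_add] using h3) n hn'
  simp only [zero_add, Bool.or_eq_true, Nat.beq_eq] at h4
  have h12 : √12 ^ 2 = 12 := Real.sq_sqrt (by norm_num)
  clear h3 heq hB
  refine abs_sub_le_of_boundTest (T := T) hn hS ?_ ?_ (h4.resolve_left (by omega))
  · refine le_of_sq_le_sq ?_ (by positivity)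
    rw [mul_pow, h12, mul_comm]
    exact_mod_cast h1
  · refine le_of_sq_le_sq ?_ (by positivity)
    rw [mul_pow, h12, mul_comm]
    exact_mod_cast h2

lemma abs_card_partition_sub_le_of_one_le {n : ℕ} (hn : 1 ≤ n) :
    |(Fintype.card (Nat.Partition n) : ℝ) - √12 / (24 * n - 1) *
      (1 - 1 / (π * √(24 * n - 1) / 6)) * Real.exp (π * √(24 * n - 1) / 6)| ≤
      √12 / (24 * n) * Real.exp (π * √(24 * n - 1) / 6 / 2) := by
  rcases lt_or_ge n 973 with h | h
  · exact abs_card_partition_sub_le_of_lt hn h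
  have hn' : (973 : ℝ) ≤ n := by exact_mod_cast h
  have hr : √(24 * n - 1) ^ 2 = (24 * n - 1 : ℝ) := Real.sq_sqrt (by linarith)
  have hpi := Real.pi_gt_d4
  have hr1 : (152.81 : ℝ) ≤ √(24 * n - 1) := by
    refine Real.le_sqrt_of_sq_le ?_
    norm_num
    linarith
  refine (abs_card_partition_sub_le (μ := π * √(24 * n - 1) / 6) ?_ ?_).trans ?_
  · norm_num at hpi hr1 ⊢
    nlinarith
  · rw [div_pow, mul_pow, hr]
    field_simp
    norm_num
  · gcongr
    rw [mul_div_assoc', div_le_div_iff₀ (by linarith) (by linarith)]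
    have : 0 < √12 := by positivity
    nlinarith

theorem stmt6 (n : ℕ) (hn : 1 ≤ n) :
    |4 * Real.sqrt 3 * (n : ℝ) * Real.exp (-(π * Real.sqrt (2 * n / 3))) * p n -
        ∑' m : ℕ, c m / (n : ℝ) ^ ((m : ℝ) / 2)| ≤
      Real.exp (-(π / 2 * Real.sqrt (2 * n / 3))) := by
  have hn' : (1 : ℝ) ≤ n := by exact_mod_cast hn
  have hR : (0 : ℝ) < 24 * n - 1 := by linarith
  have hsqrt : √(24 * n) = 6 * √(2 * n / 3) := by
    rw [Real.sqrt_eq_iff_mul_self_eq (by positivity) (by positivity)]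
    have : √(2 * n / 3) * √(2 * n / 3) = 2 * n / 3 := Real.mul_self_sqrt (by positivity)
    linear_combination (-36) * this
  have h36 : √3 * √12 = 6 := by
    rw [← Real.sqrt_mul (by norm_num), show (3 * 12 : ℝ) = 6 ^ 2 by norm_num]
    exact Real.sqrt_sq (by norm_num)
  have hmono : π * √(24 * n - 1) / 6 ≤ π * √(2 * n / 3) := by
    have : √(24 * n - 1) ≤ √(24 * n) := Real.sqrt_le_sqrt (by linarith)
    rw [hsqrt] at this
    have := mul_le_mul_of_nonneg_left this Real.pi_pos.le
    linarith
  have key := abs_card_partition_sub_le_of_one_le hn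
  rw [tsum_c_eq hn, hsqrt, show π * (6 * √(2 * n / 3)) / 6 = π * √(2 * n / 3) by ring]
  generalize π * √(24 * n - 1) / 6 = μ at *
  rw [show π / 2 * √(2 * n / 3) = π * √(2 * n / 3) / 2 by ring]
  generalize π * √(2 * n / 3) = μ' at *
  have hfac : 4 * √3 * n * Real.exp (-μ') * p n -
      24 * n / (24 * n - 1) * (1 - 1 / μ) * Real.exp (μ - μ') =
      4 * √3 * n * Real.exp (-μ') * ((Fintype.card (Nat.Partition n) : ℝ) -
        √12 / (24 * n - 1) * (1 - 1 / μ) * Real.exp μ) := by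
    rw [sub_eq_add_neg μ μ', Real.exp_add, p, mul_sub]
    linear_combination ((4 * n / (24 * n - 1) * (1 - 1 / μ) * Real.exp μ * Real.exp (-μ'))) * h36
  rw [hfac, abs_mul, abs_of_nonneg (by positivity)]
  calc _ ≤ 4 * √3 * n * Real.exp (-μ') * (√12 / (24 * n) * Real.exp (μ / 2)) := by gcongr
    _ = Real.exp (-μ' + μ / 2) := by
      rw [Real.exp_add]
      field_simp
      linear_combination 4 * h36
    _ ≤ _ := by
      gcongr
      linarith
end
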